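/- arXiv:1806.04188 — 3 statements merged into one kernel-verified Lean document; each statement's English description precedes it below -/
import Mathlib

section
/- If M is a simple binary matroid containing none of I₃, F₇, or K₅ as an induced restriction, then the critical number of M satisfies χ(M) ≤ 2. -/
/-- A simple binary matroid `M = (E, G)`: a dimension `n` together with a ground set `E`
of nonzero vectors of `𝔽₂ⁿ` (the points of `G = 𝔽₂ⁿ \ {0}`). -/
structure BinMatroid where
  dim : ℕ
  E : Set (Fin dim → ZMod 2)
  zero_not_mem : 0 ∉ E

namespace BinMatroid

/-- `M.HasIR N` : `M` contains `N` as an induced restriction, i.e. there is an injective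
linear map `φ` with `φ(E(N)) = E(M) ∩ (φ(G') \ {0})`. -/
def HasIR (M N : BinMatroid) : Prop :=
  ∃ φ : (Fin N.dim → ZMod 2) →ₗ[ZMod 2] (Fin M.dim → ZMod 2),
    Function.Injective φ ∧ φ '' N.E = M.E ∩ (Set.range φ \ {0})

/-- Isomorphism of binary matroids: a bijective induced embedding. -/
def Iso (M N : BinMatroid) : Prop :=
  ∃ φ : (Fin N.dim → ZMod 2) →ₗ[ZMod 2] (Fin M.dim → ZMod 2),
    Function.Bijective φ ∧ φ '' N.E = M.E ∩ (Set.range φ \ {0})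

/-- The critical number of the induced restriction of the ground set `E` to the flat of
the subspace `F`: the least `k` such that some flat of `F` of dimension `dim F - k`
is disjoint from `E`. -/
noncomputable def critNumRes {n : ℕ} (E : Set (Fin n → ZMod 2))
    (F : Submodule (ZMod 2) (Fin n → ZMod 2)) : ℕ :=
  sInf {k : ℕ | ∃ W : Submodule (ZMod 2) (Fin n → ZMod 2), W ≤ F ∧
    Module.finrank (ZMod 2) W = Module.finrank (ZMod 2) F - k ∧
    Disjoint ((W : Set (Fin n → ZMod 2)) \ {0}) E}

/-- The critical number `χ(M)`: the least `k ≥ 0` such that some flat of dimension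
`n - k` is disjoint from `E`. -/
noncomputable def critNum (M : BinMatroid) : ℕ :=
  sInf {k : ℕ | ∃ W : Submodule (ZMod 2) (Fin M.dim → ZMod 2),
    Module.finrank (ZMod 2) W = M.dim - k ∧
    Disjoint ((W : Set (Fin M.dim → ZMod 2)) \ {0}) M.E}

/-- `M ∈ ℰ_k` : every induced restriction of `M` to a flat of dimension at least `k`
has even size. -/
def MemE (k : ℕ) (M : BinMatroid) : Prop :=
  ∀ W : Submodule (ZMod 2) (Fin M.dim → ZMod 2),
    k ≤ Module.finrank (ZMod 2) W →
    Even (M.E ∩ ((W : Set (Fin M.dim → ZMod 2)) \ {0})).ncard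

/-- `M` is full-rank: `E` spans `𝔽₂ⁿ`. -/
def FullRank (M : BinMatroid) : Prop :=
  Submodule.span (ZMod 2) M.E = ⊤

/-- `M` is (isomorphic to) the doubling of `M₀`: `M₀` is identified, via an injective
linear map `φ`, with the restriction of `M` to a hyperplane `H = range φ`, there is
`w ∈ G − (E ∪ H)`, and `E = (E ∩ H) ∪ (w + (E ∩ H))`. -/
def IsDoublingOf (M M₀ : BinMatroid) : Prop :=
  M.dim = M₀.dim + 1 ∧
  ∃ φ : (Fin M₀.dim → ZMod 2) →ₗ[ZMod 2] (Fin M.dim → ZMod 2),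
    Function.Injective φ ∧
    ∃ w : Fin M.dim → ZMod 2, w ≠ 0 ∧ w ∉ Set.range φ ∧ w ∉ M.E ∧
      M.E = φ '' M₀.E ∪ (fun x => w + x) '' (φ '' M₀.E)

/-- `M` arises from `M₀` by a (possibly empty) sequence of doublings. -/
def ArisesByDoublings (M M₀ : BinMatroid) : Prop :=
  ∃ M' : BinMatroid,
    Relation.ReflTransGen (fun A B => IsDoublingOf B A) M₀ M' ∧ M.Iso M'

/-- `M` is (a copy of) `AG°(t−1, 2)`, the matroid `((G − H) ∪ {x}, G)` with `H` a
hyperplane of `G` and `x ∈ H`, where `t = M.dim`. -/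
def IsAGo (M : BinMatroid) : Prop :=
  ∃ H : Submodule (ZMod 2) (Fin M.dim → ZMod 2),
    Module.finrank (ZMod 2) H + 1 = M.dim ∧
    ∃ x ∈ (H : Set (Fin M.dim → ZMod 2)) \ {0},
      M.E = ({v | v ≠ 0} \ (H : Set (Fin M.dim → ZMod 2))) ∪ {x}

/-- `M` is a Bose–Burton geometry of order `k`: `E = G − F` for a flat `F` of
dimension `n − k`. -/
def IsBoseBurton (M : BinMatroid) (k : ℕ) : Prop :=
  k ≤ M.dim ∧ ∃ W : Submodule (ZMod 2) (Fin M.dim → ZMod 2),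
    Module.finrank (ZMod 2) W = M.dim - k ∧
    M.E = {v | v ≠ 0} \ (W : Set (Fin M.dim → ZMod 2))

/-- The ground set `E` (of a matroid of the ambient dimension `n`) is the semidoubling
of its restriction to the hyperplane `H₁` with respect to the hyperplane `H₀` of `H₁`:
there is `w ∈ G − (E ∪ H₁)` with `|{x, x+w} ∩ E| ∈ {0, 2}` for every `x ∈ H₀` and
`|{x, x+w} ∩ E| = 1` for every `x ∈ H₁ − H₀`. -/
def IsSemidoublingWrt {n : ℕ} (E : Set (Fin n → ZMod 2))
    (H₁ H₀ : Submodule (ZMod 2) (Fin n → ZMod 2)) : Prop :=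
  H₀ ≤ H₁ ∧ Module.finrank (ZMod 2) H₀ + 1 = Module.finrank (ZMod 2) H₁ ∧
  ∃ w : Fin n → ZMod 2, w ≠ 0 ∧ w ∉ H₁ ∧ w ∉ E ∧
    (∀ x ∈ (H₀ : Set (Fin n → ZMod 2)) \ {0},
      (({x, x + w} : Set (Fin n → ZMod 2)) ∩ E).ncard = 0 ∨
      (({x, x + w} : Set (Fin n → ZMod 2)) ∩ E).ncard = 2) ∧
    (∀ x ∈ (H₁ : Set (Fin n → ZMod 2)) \ (H₀ : Set (Fin n → ZMod 2)),
      (({x, x + w} : Set (Fin n → ZMod 2)) ∩ E).ncard = 1)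

/-- The ground set `E` is a semidoubling of its restriction to the hyperplane `H₁`
(with respect to some hyperplane `H₀` of `H₁`). -/
def IsSemidoublingOfRes {n : ℕ} (E : Set (Fin n → ZMod 2))
    (H₁ : Submodule (ZMod 2) (Fin n → ZMod 2)) : Prop :=
  ∃ H₀ : Submodule (ZMod 2) (Fin n → ZMod 2), IsSemidoublingWrt E H₁ H₀

/-- `M` is (isomorphic to) a semidoubling of `M₀`: `M₀` is identified, via an injective
linear map `φ`, with the restriction of `M` to the hyperplane `range φ`, and `M` is a
semidoubling of that restriction. -/
def IsSemidoublingOf (M M₀ : BinMatroid) : Prop :=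
  M.dim = M₀.dim + 1 ∧
  ∃ φ : (Fin M₀.dim → ZMod 2) →ₗ[ZMod 2] (Fin M.dim → ZMod 2),
    Function.Injective φ ∧
    φ '' M₀.E = M.E ∩ (Set.range φ \ {0}) ∧
    IsSemidoublingOfRes M.E (LinearMap.range φ)

/-- `M` arises from `M₀` by a (possibly empty) sequence of semidoublings. -/
def ArisesBySemidoublings (M M₀ : BinMatroid) : Prop :=
  ∃ M' : BinMatroid,
    Relation.ReflTransGen (fun A B => IsSemidoublingOf B A) M₀ M' ∧ M.Iso M'

end BinMatroid

/-- A triangle of `G`: a set `{x, y, z}` of three distinct nonzero vectors with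
`x + y + z = 0`. -/
def IsTriangle {n : ℕ} (T : Set (Fin n → ZMod 2)) : Prop :=
  ∃ x y z : Fin n → ZMod 2, x ≠ 0 ∧ y ≠ 0 ∧ z ≠ 0 ∧
    x ≠ y ∧ x ≠ z ∧ y ≠ z ∧ x + y + z = 0 ∧ T = {x, y, z}

/-- `I₃`, the claw: the 3-dimensional matroid whose ground set is the three standard
basis vectors of `𝔽₂³`. -/
def I3 : BinMatroid where
  dim := 3
  E := Set.range fun i : Fin 3 => (Pi.single i 1 : Fin 3 → ZMod 2)
  zero_not_mem := by
    rintro ⟨i, hi⟩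
    have := congrFun hi i
    simp [Pi.single_eq_same] at this

/-- `F₇`, the Fano plane: the 3-dimensional matroid whose ground set is all of
`𝔽₂³ \ {0}`. -/
def F7 : BinMatroid where
  dim := 3
  E := {v | v ≠ 0}
  zero_not_mem := by simp

/-- `K₅`: the 4-dimensional matroid whose ground set is the set of vectors of Hamming
weight 1 or 2 in `𝔽₂⁴`. -/
def K5 : BinMatroid where
  dim := 4
  E := {v | hammingNorm v = 1 ∨ hammingNorm v = 2}
  zero_not_mem := by
    intro h
    simp only [Set.mem_setOf_eq, hammingNorm_zero] at h
    omega


theorem hasIR_of (M N : BinMatroid)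
    (φ : (Fin N.dim → ZMod 2) →ₗ[ZMod 2] (Fin M.dim → ZMod 2))
    (h0 : ∀ v, φ v = 0 → v = 0) (h : ∀ v, v ∈ N.E ↔ φ v ∈ M.E) : M.HasIR N := by
  refine ⟨φ, (injective_iff_map_eq_zero φ).2 h0, ?_⟩
  ext y
  constructor
  · rintro ⟨v, hv, rfl⟩
    refine ⟨(h v).1 hv, ⟨v, rfl⟩, ?_⟩
    intro hz
    have := (h v).1 hv
    rw [Set.mem_singleton_iff.1 hz] at this
    exact M.zero_not_mem this
  · rintro ⟨hy, ⟨v, rfl⟩, -⟩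
    exact ⟨v, (h v).2 hy, rfl⟩

theorem hasIR_of_pred (M : BinMatroid) (k : ℕ) (D : Set (Fin k → ZMod 2)) (hD : 0 ∉ D)
    (P : (Fin k → ZMod 2) → Prop) (hP : ∀ v, v ∈ D ↔ P v)
    (φ : (Fin k → ZMod 2) →ₗ[ZMod 2] (Fin M.dim → ZMod 2))
    (h0 : ∀ v, φ v = 0 → v = 0) (h : ∀ v, P v ↔ φ v ∈ M.E) : M.HasIR ⟨k, D, hD⟩ :=
  hasIR_of M ⟨k, D, hD⟩ φ h0 fun v => (hP v).trans (h v)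

theorem zmod2_cases (a : ZMod 2) : a = 0 ∨ a = 1 := by
  revert a; decide

theorem vec3_cases {P : (Fin 3 → ZMod 2) → Prop}
    (h : ∀ a b c : ZMod 2, P ![a, b, c]) (v : Fin 3 → ZMod 2) : P v := by
  have : v = ![v 0, v 1, v 2] := by
    ext i; fin_cases i <;> rfl
  rw [this]; exact h _ _ _

theorem vec4_cases {P : (Fin 4 → ZMod 2) → Prop}
    (h : ∀ a b c d : ZMod 2, P ![a, b, c, d]) (v : Fin 4 → ZMod 2) : P v := by
  have : v = ![v 0, v 1, v 2, v 3] := by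
    ext i; fin_cases i <;> rfl
  rw [this]; exact h _ _ _ _

theorem two_zero (n : ℕ) : (2 : Fin n → ZMod 2) = 0 := by
  funext i; exact (by decide : (2 : ZMod 2) = 0)

theorem no_fano (M : BinMatroid) (hF7 : ¬ M.HasIR F7) (x y z : Fin M.dim → ZMod 2)
    (hx : x ∈ M.E) (hy : y ∈ M.E) (hz : z ∈ M.E) (hxy : x + y ∈ M.E) (hxz : x + z ∈ M.E)
    (hyz : y + z ∈ M.E) (hxyz : x + y + z ∈ M.E) : False := by
  have hne : ∀ a, a ∈ M.E → a ≠ 0 := fun a ha h => M.zero_not_mem (h ▸ ha)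
  apply hF7
  have h0 := M.zero_not_mem
  refine hasIR_of_pred M 3 F7.E F7.zero_not_mem (fun v => v ≠ 0)
    (fun v => Iff.rfl) (Fintype.linearCombination (ZMod 2) ![x, y, z]) ?_ ?_
  · refine vec3_cases fun a b c => ?_
    rcases zmod2_cases a with rfl | rfl <;> rcases zmod2_cases b with rfl | rfl <;>
      rcases zmod2_cases c with rfl | rfl <;>
      simp [Fintype.linearCombination_apply, Fin.sum_univ_succ, ← add_assoc, *]
  · refine vec3_cases fun a b c => ?_
    rcases zmod2_cases a with rfl | rfl <;> rcases zmod2_cases b with rfl | rfl <;>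
      rcases zmod2_cases c with rfl | rfl <;>
      simp [Fintype.linearCombination_apply, Fin.sum_univ_succ, ← add_assoc, *]

theorem no_claw (M : BinMatroid) (hI3 : ¬ M.HasIR I3) (x y z : Fin M.dim → ZMod 2)
    (hx : x ∈ M.E) (hy : y ∈ M.E) (hz : z ∈ M.E) (hxy : x + y ≠ 0) (hxz : x + z ≠ 0)
    (hyz : y + z ≠ 0) (hxyz : x + y + z ≠ 0) (hs : x + y + z ∉ M.E) :
    x + y ∈ M.E ∨ x + z ∈ M.E ∨ y + z ∈ M.E := by
  by_contra! hcon
  obtain ⟨h1, h2, h3⟩ := hcon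
  have hne : ∀ a, a ∈ M.E → a ≠ 0 := fun a ha h => M.zero_not_mem (h ▸ ha)
  apply hI3
  have h0 := M.zero_not_mem
  refine hasIR_of_pred M 3 I3.E I3.zero_not_mem (fun v => ∃ i : Fin 3, (Pi.single i 1 : Fin 3 → ZMod 2) = v)
    (fun v => Iff.rfl) (Fintype.linearCombination (ZMod 2) ![x, y, z]) ?_ ?_
  · refine vec3_cases fun a b c => ?_
    rcases zmod2_cases a with rfl | rfl <;> rcases zmod2_cases b with rfl | rfl <;>
      rcases zmod2_cases c with rfl | rfl <;>
      simp [Fintype.linearCombination_apply, Fin.sum_univ_succ, ← add_assoc, *]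
  · refine vec3_cases fun a b c => ?_
    have dec : ∀ a b c : ZMod 2, (∃ i : Fin 3, (Pi.single i 1 : Fin 3 → ZMod 2) = ![a, b, c]) ↔
      (a = 1 ∧ b = 0 ∧ c = 0) ∨ (a = 0 ∧ b = 1 ∧ c = 0) ∨ (a = 0 ∧ b = 0 ∧ c = 1) := by decide
    rw [dec]
    rcases zmod2_cases a with rfl | rfl <;> rcases zmod2_cases b with rfl | rfl <;>
      rcases zmod2_cases c with rfl | rfl <;>
      simp [Fintype.linearCombination_apply, Fin.sum_univ_succ, ← add_assoc, *]

/-- No `5`-clique in the Cayley graph. -/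
theorem no_clique (M : BinMatroid) (hF7 : ¬ M.HasIR F7) (hK5 : ¬ M.HasIR K5)
    (x y z t : Fin M.dim → ZMod 2)
    (hx : x ∈ M.E) (hy : y ∈ M.E) (hz : z ∈ M.E) (ht : t ∈ M.E)
    (hxy : x + y ∈ M.E) (hxz : x + z ∈ M.E) (hxt : x + t ∈ M.E)
    (hyz : y + z ∈ M.E) (hyt : y + t ∈ M.E) (hzt : z + t ∈ M.E)
    (n1 : x + y + z ≠ 0) (n2 : x + y + t ≠ 0) (n3 : x + z + t ≠ 0) (n4 : y + z + t ≠ 0)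
    (n5 : x + y + z + t ≠ 0) : False := by
  have two := two_zero M.dim
  have hne : ∀ a, a ∈ M.E → a ≠ 0 := fun a ha h => M.zero_not_mem (h ▸ ha)
  have h0 := M.zero_not_mem
  have m1 : x + y + z ∉ M.E := fun h => no_fano M hF7 x y z hx hy hz hxy hxz hyz h
  have m2 : x + y + t ∉ M.E := fun h => no_fano M hF7 x y t hx hy ht hxy hxt hyt h
  have m3 : x + z + t ∉ M.E := fun h => no_fano M hF7 x z t hx hz ht hxz hxt hzt h
  have m4 : y + z + t ∉ M.E := fun h => no_fano M hF7 y z t hy hz ht hyz hyt hzt h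
  by_cases m5 : x + y + z + t ∈ M.E
  · refine no_fano M hF7 (x + y) (x + z) (x + t) hxy hxz hxt ?_ ?_ ?_ ?_
    · rwa [show x + y + (x + z) = y + z by grind]
    · rwa [show x + y + (x + t) = y + t by grind]
    · rwa [show x + z + (x + t) = z + t by grind]
    · rwa [show x + y + (x + z) + (x + t) = x + y + z + t by grind]
  apply hK5
  refine hasIR_of_pred M 4 K5.E K5.zero_not_mem (fun v => hammingNorm v = 1 ∨ hammingNorm v = 2)
    (fun v => Iff.rfl) (Fintype.linearCombination (ZMod 2) ![x, y, z, t]) ?_ ?_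
  · refine vec4_cases fun a b c d => ?_
    rcases zmod2_cases a with rfl | rfl <;> rcases zmod2_cases b with rfl | rfl <;>
      rcases zmod2_cases c with rfl | rfl <;> rcases zmod2_cases d with rfl | rfl <;>
      simp [Fintype.linearCombination_apply, Fin.sum_univ_succ, ← add_assoc, *]
  · have dec : ∀ a b c d : ZMod 2,
      (hammingNorm ![a, b, c, d] = 1 ∨ hammingNorm ![a, b, c, d] = 2) ↔
      (a.val + b.val + c.val + d.val = 1 ∨ a.val + b.val + c.val + d.val = 2) := by decide
    refine vec4_cases fun a b c d => ?_
    rw [dec]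
    rcases zmod2_cases a with rfl | rfl <;> rcases zmod2_cases b with rfl | rfl <;>
      rcases zmod2_cases c with rfl | rfl <;> rcases zmod2_cases d with rfl | rfl <;>
      simp [Fintype.linearCombination_apply, Fin.sum_univ_succ, ← add_assoc, ZMod.val_one, *]

theorem prop_aux (P1 P2 P3 Q1 Q2 Q3 : Prop) (c0 : P1 ∨ P2 ∨ P3) (c1 : Q1 ∨ Q2 ∨ P3)
    (c2 : Q1 ∨ P2 ∨ Q3) (c3 : P1 ∨ Q2 ∨ Q3) (f1 : P1 → ¬ Q1) (f2 : P2 → ¬ Q2) (f3 : P3 → ¬ Q3)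
    (k0 : P1 → P2 → P3 → False) (k1 : Q1 → Q2 → P3 → False) (k2 : Q1 → P2 → Q3 → False)
    (k3 : P1 → Q2 → Q3 → False) : False := by
  by_cases P1 <;> by_cases P2 <;> by_cases P3 <;> by_cases Q1 <;> by_cases Q2 <;>
    by_cases Q3 <;> simp_all

set_option maxHeartbeats 1000000 in
/-- The key lemma. -/
theorem key_lemma (M : BinMatroid)
    (hI3 : ¬ M.HasIR I3) (hF7 : ¬ M.HasIR F7) (hK5 : ¬ M.HasIR K5)
    (p b₁ b₂ b₃ e : Fin M.dim → ZMod 2) (he : b₁ + b₂ + b₃ = e) (heE : e ∉ M.E)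
    (hp : p ∈ M.E) (h1 : b₁ ∈ M.E) (h2 : b₂ ∈ M.E) (h3 : b₃ ∈ M.E)
    (h1' : b₁ + p ∈ M.E) (h2' : b₂ + p ∈ M.E) (h3' : b₃ + p ∈ M.E)
    (n12 : b₁ + b₂ ≠ 0) (n12' : b₁ + b₂ + p ≠ 0)
    (n13 : b₁ + b₃ ≠ 0) (n13' : b₁ + b₃ + p ≠ 0)
    (n23 : b₂ + b₃ ≠ 0) (n23' : b₂ + b₃ + p ≠ 0) (nep : e + p ≠ 0) : False := by
  have two := two_zero M.dim
  subst he
  by_cases e0 : b₁ + b₂ + b₃ = 0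
  · refine no_fano M hF7 b₁ b₂ p h1 h2 hp ?_ h1' h2' ?_
    · rwa [show b₁ + b₂ = b₃ by grind]
    · rwa [show b₁ + b₂ + p = b₃ + p by grind]
  -- claws
  have c0 := no_claw M hI3 b₁ b₂ b₃ h1 h2 h3 n12 n13 n23 e0 heE
  have c1 := no_claw M hI3 b₁ (b₂ + p) (b₃ + p) h1 h2' h3' (fun h => n12' (Eq.trans (by clear * - two; grind) h))
      (fun h => n13' (Eq.trans (by clear * - two; grind) h))
      (fun h => n23 (Eq.trans (by clear * - two; grind) h))
    (fun h => e0 (Eq.trans (by clear * - two; grind) h)) (by rwa [show b₁ + (b₂ + p) + (b₃ + p) = b₁ + b₂ + b₃ by clear * - two; grind])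
  have c2 := no_claw M hI3 (b₁ + p) b₂ (b₃ + p) h1' h2 h3' (fun h => n12' (Eq.trans (by clear * - two; grind) h))
      (fun h => n13 (Eq.trans (by clear * - two; grind) h))
      (fun h => n23' (Eq.trans (by clear * - two; grind) h))
    (fun h => e0 (Eq.trans (by clear * - two; grind) h)) (by rwa [show b₁ + p + b₂ + (b₃ + p) = b₁ + b₂ + b₃ by clear * - two; grind])
  have c3 := no_claw M hI3 (b₁ + p) (b₂ + p) b₃ h1' h2' h3 (fun h => n12 (Eq.trans (by clear * - two; grind) h))
      (fun h => n13' (Eq.trans (by clear * - two; grind) h))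
      (fun h => n23' (Eq.trans (by clear * - two; grind) h))
    (fun h => e0 (Eq.trans (by clear * - two; grind) h)) (by rwa [show b₁ + p + (b₂ + p) + b₃ = b₁ + b₂ + b₃ by clear * - two; grind])
  rw [show b₁ + (b₂ + p) = b₁ + b₂ + p by grind, show b₁ + (b₃ + p) = b₁ + b₃ + p by grind,
    show b₂ + p + (b₃ + p) = b₂ + b₃ by clear * - two; grind] at c1
  rw [show b₁ + p + b₂ = b₁ + b₂ + p by grind, show b₁ + p + (b₃ + p) = b₁ + b₃ by grind,
    show b₂ + (b₃ + p) = b₂ + b₃ + p by clear * - two; grind] at c2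
  rw [show b₁ + p + (b₂ + p) = b₁ + b₂ by grind, show b₁ + p + b₃ = b₁ + b₃ + p by grind,
    show b₂ + p + b₃ = b₂ + b₃ + p by clear * - two; grind] at c3
  -- Fano
  have f12 : b₁ + b₂ ∈ M.E → b₁ + b₂ + p ∉ M.E :=
    fun h h' => no_fano M hF7 b₁ b₂ p h1 h2 hp h h1' h2' h'
  have f13 : b₁ + b₃ ∈ M.E → b₁ + b₃ + p ∉ M.E :=
    fun h h' => no_fano M hF7 b₁ b₃ p h1 h3 hp h h1' h3' h'
  have f23 : b₂ + b₃ ∈ M.E → b₂ + b₃ + p ∉ M.E :=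
    fun h h' => no_fano M hF7 b₂ b₃ p h2 h3 hp h h2' h3' h'
  -- cliques
  have hclique : ∀ x y z, x ∈ M.E → y ∈ M.E → z ∈ M.E → x + p ∈ M.E → y + p ∈ M.E → z + p ∈ M.E →
      x + y ∈ M.E → x + z ∈ M.E → y + z ∈ M.E → x + y + p ≠ 0 → x + z + p ≠ 0 → y + z + p ≠ 0 →
      x + y + z ≠ 0 → x + y + z + p ≠ 0 → False :=
    fun x y z hx hy hz hx' hy' hz' hxy hxz hyz a1 a2 a3 a4 a5 =>
      no_clique M hF7 hK5 x y z p hx hy hz hp hxy hxz hx' hyz hy' hz' a4 a1 a2 a3 a5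
  have pp : ∀ x, x ∈ M.E → x + p + p ∈ M.E := fun x hx => by rwa [show x + p + p = x by clear * - two; grind]
  have k0 : b₁ + b₂ ∈ M.E → b₁ + b₃ ∈ M.E → b₂ + b₃ ∈ M.E → False := by
    intro q1 q2 q3
    refine hclique (b₁ + p) (b₂ + p) (b₃ + p) h1' h2' h3' (pp _ h1) (pp _ h2) (pp _ h3)
      ?_ ?_ ?_ (fun h => n12' (Eq.trans (by clear * - two; grind) h))
      (fun h => n13' (Eq.trans (by clear * - two; grind) h))
      (fun h => n23' (Eq.trans (by clear * - two; grind) h))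
      (fun h => nep (Eq.trans (by clear * - two; grind) h))
      (fun h => e0 (Eq.trans (by clear * - two; grind) h))
    · rwa [show b₁ + p + (b₂ + p) = b₁ + b₂ by clear * - two; grind]
    · rwa [show b₁ + p + (b₃ + p) = b₁ + b₃ by clear * - two; grind]
    · rwa [show b₂ + p + (b₃ + p) = b₂ + b₃ by clear * - two; grind]
  have k1 : b₁ + b₂ + p ∈ M.E → b₁ + b₃ + p ∈ M.E → b₂ + b₃ ∈ M.E → False := by
    intro q1 q2 q3
    refine hclique (b₁ + p) b₂ b₃ h1' h2 h3 (pp _ h1) h2' h3'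
      ?_ ?_ q3 (fun h => n12 (Eq.trans (by clear * - two; grind) h))
      (fun h => n13 (Eq.trans (by clear * - two; grind) h))
      (fun h => n23' (Eq.trans (by clear * - two; grind) h))
      (fun h => nep (Eq.trans (by clear * - two; grind) h))
      (fun h => e0 (Eq.trans (by clear * - two; grind) h))
    · rwa [show b₁ + p + b₂ = b₁ + b₂ + p by clear * - two; grind]
    · rwa [show b₁ + p + b₃ = b₁ + b₃ + p by clear * - two; grind]
  have k2 : b₁ + b₂ + p ∈ M.E → b₁ + b₃ ∈ M.E → b₂ + b₃ + p ∈ M.E → False := by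
    intro q1 q2 q3
    refine hclique b₁ (b₂ + p) b₃ h1 h2' h3 h1' (pp _ h2) h3'
      ?_ q2 ?_ (fun h => n12 (Eq.trans (by clear * - two; grind) h))
      (fun h => n13' (Eq.trans (by clear * - two; grind) h))
      (fun h => n23 (Eq.trans (by clear * - two; grind) h))
      (fun h => nep (Eq.trans (by clear * - two; grind) h))
      (fun h => e0 (Eq.trans (by clear * - two; grind) h))
    · rwa [show b₁ + (b₂ + p) = b₁ + b₂ + p by clear * - two; grind]
    · rwa [show b₂ + p + b₃ = b₂ + b₃ + p by clear * - two; grind]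
  have k3 : b₁ + b₂ ∈ M.E → b₁ + b₃ + p ∈ M.E → b₂ + b₃ + p ∈ M.E → False := by
    intro q1 q2 q3
    refine hclique b₁ b₂ (b₃ + p) h1 h2 h3' h1' h2' (pp _ h3)
      q1 ?_ ?_ (fun h => n12' (Eq.trans (by clear * - two; grind) h))
      (fun h => n13 (Eq.trans (by clear * - two; grind) h))
      (fun h => n23 (Eq.trans (by clear * - two; grind) h))
      (fun h => nep (Eq.trans (by clear * - two; grind) h))
      (fun h => e0 (Eq.trans (by clear * - two; grind) h))
    · rwa [show b₁ + (b₃ + p) = b₁ + b₃ + p by clear * - two; grind]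
    · rwa [show b₂ + (b₃ + p) = b₂ + b₃ + p by clear * - two; grind]
  exact prop_aux _ _ _ _ _ _ c0 c1 c2 c3 f12 f13 f23 k0 k1 k2 k3

/-- In a codimension `≥ 3` maximal avoiding subspace we get a contradiction. -/
theorem no_max (M : BinMatroid)
    (hI3 : ¬ M.HasIR I3) (hF7 : ¬ M.HasIR F7) (hK5 : ¬ M.HasIR K5)
    (W : Submodule (ZMod 2) (Fin M.dim → ZMod 2)) (hW : ∀ w ∈ W, w ∉ M.E)
    (hmax : ∀ a, a ∉ W → ∃ x ∈ M.E, x + a ∈ W)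
    (hdim : Module.finrank (ZMod 2) W + 3 ≤ M.dim) : False := by
  have two := two_zero M.dim
  have hne : ∀ a, a ∈ M.E → a ≠ 0 := fun a ha h => M.zero_not_mem (h ▸ ha)
  have hV : Module.finrank (ZMod 2) (Fin M.dim → ZMod 2) = M.dim := by simp
  have ext1 : ∀ U : Submodule (ZMod 2) (Fin M.dim → ZMod 2),
      Module.finrank (ZMod 2) U < M.dim → ∃ a, a ∉ U := by
    intro U hU
    by_contra! h
    have : U = ⊤ := by ext a; simp [h a]
    rw [this, finrank_top, hV] at hU
    omega
  have sup1 : ∀ (U : Submodule (ZMod 2) (Fin M.dim → ZMod 2)) (a : Fin M.dim → ZMod 2),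
      Module.finrank (ZMod 2) (U ⊔ Submodule.span (ZMod 2) {a} :
        Submodule (ZMod 2) (Fin M.dim → ZMod 2)) ≤ Module.finrank (ZMod 2) U + 1 := by
    intro U a
    refine (Submodule.finrank_add_le_finrank_add_finrank U _).trans ?_
    have := finrank_span_le_card (R := ZMod 2) ({a} : Set (Fin M.dim → ZMod 2))
    simp at this
    omega
  -- the coset with fewest points
  obtain ⟨m₀, hm₀⟩ := ext1 W (by omega)
  obtain ⟨m, hm, hmin⟩ := Set.exists_min_image {a | a ∉ W}
    (fun a => {x | x ∈ M.E ∧ x + a ∈ W}.ncard) (Set.toFinite _) ⟨m₀, hm₀⟩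
  obtain ⟨p, hp, hpm⟩ := hmax m hm
  have hpW : p ∉ W := fun h => hW p h hp
  have claim : ∀ a, a ∉ W → a + p ∉ W →
      ∃ b, b ∈ M.E ∧ b + p ∈ M.E ∧ (b + a ∈ W ∨ b + a + p ∈ W) := by
    intro a ha hap
    by_contra! hcon
    obtain ⟨x, hx, hxa⟩ := hmax a ha
    have hxp : x + p ∉ M.E := fun h => (hcon x hx h).1 hxa
    have hle := hmin (a + p) hap
    have hlt : {y | y ∈ M.E ∧ y + (a + p) ∈ W}.ncard < {y | y ∈ M.E ∧ y + m ∈ W}.ncard := by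
      rw [← Set.ncard_image_of_injective {y | y ∈ M.E ∧ y + (a + p) ∈ W} (add_right_injective x)]
      apply Set.ncard_lt_ncard _ (Set.toFinite _)
      refine (Set.ssubset_iff_of_subset ?_).2 ⟨p, ⟨hp, hpm⟩, ?_⟩
      · rintro _ ⟨y, ⟨hy, hyW⟩, rfl⟩
        have hyp : y + p ∉ M.E := fun h => (hcon y hy h).2 (by rwa [add_assoc])
        have hsW : x + y + p ∈ W := by
          have := W.add_mem hxa hyW
          rwa [show x + a + (y + (a + p)) = x + y + p by grind] at this
        have hs0 : x + y + p ≠ 0 := by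
          intro h
          apply hxp
          rwa [show x + p = y by grind]
        have := no_claw M hI3 x y p hx hy hp ?_ ?_ ?_ hs0 (hW _ hsW)
        · refine ⟨by tauto, ?_⟩
          have := W.add_mem hsW hpm
          rwa [show x + y + p + (p + m) = x + y + m by grind] at this
        · intro h
          apply hpW
          rwa [h, zero_add] at hsW
        · intro h
          have : x = p := by grind
          apply hap
          rw [← this, add_comm]; exact hxa
        · intro h
          have : y = p := by grind
          apply ha
          rwa [this, show p + (a + p) = a by grind] at hyW
      · rintro ⟨y, ⟨hy, hyW⟩, hxy⟩
        apply hxp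
        have hxy' : x + y = p := hxy
        rwa [show x + p = y by grind]
    have : {y | y ∈ M.E ∧ y + m ∈ W}.ncard ≤ {y | y ∈ M.E ∧ y + (a + p) ∈ W}.ncard := hle
    omega
  -- two independent directions
  have s1 := sup1 W p
  obtain ⟨a₁, ha₁⟩ := ext1 (W ⊔ Submodule.span (ZMod 2) {p}) (by omega)
  have s2 := sup1 (W ⊔ Submodule.span (ZMod 2) {p}) a₁
  obtain ⟨a₂, ha₂⟩ := ext1 (W ⊔ Submodule.span (ZMod 2) {p} ⊔ Submodule.span (ZMod 2) {a₁})
    (by omega)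
  set P := W ⊔ Submodule.span (ZMod 2) {p} with hP
  have hWP : W ≤ P := le_sup_left
  have hpP : p ∈ P := (le_sup_right : _ ≤ P) (Submodule.mem_span_singleton_self p)
  have ha₁' : a₁ ∈ P ⊔ Submodule.span (ZMod 2) {a₁} :=
    (le_sup_right : _ ≤ P ⊔ Submodule.span (ZMod 2) {a₁}) (Submodule.mem_span_singleton_self a₁)
  have ha₂P : a₂ ∉ P := fun h => ha₂ ((le_sup_left : P ≤ _) h)
  have ha₁₂P : a₁ + a₂ ∉ P := by
    intro h
    apply ha₂
    have := Submodule.add_mem _ ((le_sup_left : P ≤ P ⊔ Submodule.span (ZMod 2) {a₁}) h) ha₁'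
    rwa [show a₁ + a₂ + a₁ = a₂ by grind] at this
  have claimP : ∀ a, a ∉ P → ∃ b, b ∈ M.E ∧ b + p ∈ M.E ∧ b + a ∈ W := by
    intro a ha
    have hap : a + p ∉ P := by
      intro h
      apply ha
      have := P.add_mem h hpP
      rwa [show a + p + p = a by grind] at this
    obtain ⟨b, hb, hbp, h | h⟩ := claim a (fun h => ha (hWP h)) (fun h => hap (hWP h))
    · exact ⟨b, hb, hbp, h⟩
    · refine ⟨b + p, hbp, by rwa [show b + p + p = b by grind], ?_⟩
      rwa [show b + p + a = b + a + p by grind]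
  obtain ⟨b₁, h1, h1', w1⟩ := claimP a₁ ha₁
  obtain ⟨b₂, h2, h2', w2⟩ := claimP a₂ ha₂P
  obtain ⟨b₃, h3, h3', w3⟩ := claimP (a₁ + a₂) ha₁₂P
  have heW : b₁ + b₂ + b₃ ∈ W := by
    have := W.add_mem (W.add_mem w1 w2) w3
    rwa [show b₁ + a₁ + (b₂ + a₂) + (b₃ + (a₁ + a₂)) = b₁ + b₂ + b₃ by grind] at this
  have nz : ∀ c, c ∉ P → ∀ d, d + c ∈ W → d ≠ 0 ∧ d + p ≠ 0 := by
    intro c hc d hd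
    constructor
    · rintro rfl
      exact hc (hWP (by simpa using hd))
    · intro h
      have : d = p := by grind
      subst this
      apply hc
      have := P.add_mem (hWP hd) hpP
      rwa [show d + c + d = c by grind] at this
  have q12 := nz _ ha₁₂P (b₁ + b₂) (by
    have := W.add_mem w1 w2
    rwa [show b₁ + a₁ + (b₂ + a₂) = b₁ + b₂ + (a₁ + a₂) by grind] at this)
  have q13 := nz _ ha₂P (b₁ + b₃) (by
    have := W.add_mem w1 w3
    rwa [show b₁ + a₁ + (b₃ + (a₁ + a₂)) = b₁ + b₃ + a₂ by grind] at this)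
  have q23 := nz _ ha₁ (b₂ + b₃) (by
    have := W.add_mem w2 w3
    rwa [show b₂ + a₂ + (b₃ + (a₁ + a₂)) = b₂ + b₃ + a₁ by grind] at this)
  refine key_lemma M hI3 hF7 hK5 p b₁ b₂ b₃ _ rfl (hW _ heW) hp h1 h2 h3 h1' h2' h3'
    q12.1 q12.2 q13.1 q13.2 q23.1 q23.2 ?_
  intro h
  apply hpW
  rwa [show b₁ + b₂ + b₃ = p by grind] at heW

theorem main_aux (M : BinMatroid)
    (hI3 : ¬ M.HasIR I3) (hF7 : ¬ M.HasIR F7) (hK5 : ¬ M.HasIR K5) :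
    M.critNum ≤ 2 := by
  have two := two_zero M.dim
  obtain ⟨W, hW, hmax⟩ := Set.exists_max_image
    {W : Submodule (ZMod 2) (Fin M.dim → ZMod 2) | ∀ w ∈ W, w ∉ M.E}
    (fun W => Module.finrank (ZMod 2) W) (Set.toFinite _)
    ⟨⊥, by rintro w hw; rw [(Submodule.mem_bot _).1 hw]; exact M.zero_not_mem⟩
  have hW' : ∀ w ∈ W, w ∉ M.E := hW
  by_cases hdim : Module.finrank (ZMod 2) W + 3 ≤ M.dim
  · exfalso
    refine no_max M hI3 hF7 hK5 W hW ?_ hdim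
    intro a ha
    by_contra! hcon
    have hlt : W < W ⊔ Submodule.span (ZMod 2) {a} := by
      refine lt_of_le_of_ne le_sup_left fun h => ha ?_
      rw [h]
      exact (le_sup_right : _ ≤ W ⊔ Submodule.span (ZMod 2) {a})
        (Submodule.mem_span_singleton_self a)
    have h1 := Submodule.finrank_lt_finrank_of_lt hlt
    have h2 := hmax (W ⊔ Submodule.span (ZMod 2) {a}) (by
      intro w hw hwE
      obtain ⟨u, hu, v, hv, rfl⟩ := Submodule.mem_sup.1 hw
      obtain ⟨c, rfl⟩ := Submodule.mem_span_singleton.1 hv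
      rcases zmod2_cases c with rfl | rfl
      · exact hW' u hu (by simpa using hwE)
      · refine hcon _ hwE ?_
        rw [one_smul]
        rwa [show u + a + a = u by grind])
    omega
  · obtain ⟨U, hU⟩ : ∃ U : Submodule (ZMod 2) W,
        Module.finrank (ZMod 2) U = M.dim - 2 := by
      have hk : M.dim - 2 ≤ Module.finrank (ZMod 2) W := by omega
      let b := Module.finBasis (ZMod 2) W
      have hli : LinearIndependent (ZMod 2) (b ∘ Fin.castLE hk) :=
        b.linearIndependent.comp _ (Fin.castLE_injective hk)
      exact ⟨Submodule.span (ZMod 2) (Set.range (b ∘ Fin.castLE hk)), by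
        rw [finrank_span_eq_card hli, Fintype.card_fin]⟩
    apply Nat.sInf_le
    refine ⟨U.map W.subtype, ?_, ?_⟩
    · rw [← hU]
      exact (Submodule.equivMapOfInjective W.subtype W.injective_subtype U).finrank_eq.symm
    · rw [Set.disjoint_left]
      rintro w ⟨hw, -⟩
      obtain ⟨u, -, rfl⟩ := hw
      exact hW' _ u.2

/-- If `M` is a simple binary matroid containing none of `I₃`, `F₇`, or
`K₅` as an induced restriction, then `χ(M) ≤ 2`. -/
theorem stmt0 (M : BinMatroid)
    (hI3 : ¬ M.HasIR I3) (hF7 : ¬ M.HasIR F7) (hK5 : ¬ M.HasIR K5) :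
    M.critNum ≤ 2 := by
  exact main_aux M hI3 hF7 hK5
end

section
/- Let M be a full-rank simple binary matroid. Then M contains neither I₃ nor F₇ as an induced restriction if and only if either M ∈ ℰ₃, or there is some t ≥ 3 such that M arises from AG°(t−1, 2) by a sequence of doublings. -/
set_option linter.unusedSimpArgs false
set_option linter.unusedSectionVars false

section Generic

variable {V : Type*} [AddCommGroup V] [Module (ZMod 2) V]

theorem z2_self (a : V) : a + a = 0 := ZModModule.add_self a

theorem z2_left (a b : V) : a + (a + b) = b := by rw [← add_assoc, z2_self, zero_add]

/-- pointwise `I₃`-freeness -/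
def FreeI (E : Set V) : Prop := ∀ a b c, a ∈ E → b ∈ E → c ∈ E →
  a + b ∉ E → a + c ∉ E → b + c ∉ E → a + (b + c) ∉ E → False

/-- pointwise `F₇`-freeness -/
def FreeF (E : Set V) : Prop := ∀ a b c, a ∈ E → b ∈ E → c ∈ E →
  a + b ∈ E → a + c ∈ E → b + c ∈ E → a + (b + c) ∈ E → False

theorem rule1 {E : Set V} (hI : FreeI E) (a b k : V) (ha : a ∈ E) (hb : b ∉ E)
    (hab : a + b ∉ E) (h0 : k ∈ E) (h1 : k + a ∉ E) (h3 : k + b ∈ E) (h4 : k + b + a ∉ E) :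
    False := by
  have := hI a k (k + b)
  simp only [add_comm, add_left_comm, add_assoc, z2_self, z2_left, add_zero, zero_add] at *
  tauto

theorem rule2 {E : Set V} (hI : FreeI E) (a b k : V) (ha : a ∈ E) (hb : b ∈ E)
    (hab : a + b ∉ E) (h0 : k ∈ E) (h1 : k + a ∉ E) (h3 : k + b ∉ E) (h4 : k + a + b ∉ E) :
    False := by
  have := hI a b k
  simp only [add_comm, add_left_comm, add_assoc, z2_self, z2_left, add_zero, zero_add] at *
  tauto

theorem rule3 {E : Set V} (hF : FreeF E) (a b k : V) (ha : a ∈ E) (hb : b ∈ E)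
    (hab : a + b ∈ E) (h0 : k ∈ E) (h1 : k + a ∈ E) (h3 : k + b ∈ E) (h4 : k + a + b ∈ E) :
    False := by
  have := hF a b k
  simp only [add_comm, add_left_comm, add_assoc, z2_self, z2_left, add_zero, zero_add] at *
  tauto

theorem mem_add_left {H : Submodule (ZMod 2) V} {a b : V} (ha : a ∈ H) : a + b ∈ H ↔ b ∈ H :=
  Submodule.add_mem_iff_right H ha

theorem mem_sup_sp {P : Submodule (ZMod 2) V} {v u : V} :
    u ∈ P ⊔ Submodule.span (ZMod 2) {v} ↔ u ∈ P ∨ u + v ∈ P := by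
  rw [Submodule.mem_sup]
  constructor
  · rintro ⟨y, hy, z, hz, rfl⟩
    obtain ⟨c, rfl⟩ := Submodule.mem_span_singleton.1 hz
    have : c = 0 ∨ c = 1 := (by decide : ∀ c : ZMod 2, c = 0 ∨ c = 1) c
    rcases this with rfl | rfl
    · left; simpa using hy
    · right; rw [one_smul, add_assoc, z2_self, add_zero]; exact hy
  · rintro (h | h)
    · exact ⟨u, h, 0, Submodule.zero_mem _, add_zero _⟩
    · exact ⟨u + v, h, v, Submodule.mem_span_singleton_self v, by
        rw [add_assoc, z2_self, add_zero]⟩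

/-- `E` restricted to `W` is a repeated doubling of some `AG°(t-1,2)`. -/
structure StrAt (E : Set V) (W H U : Submodule (ZMod 2) V) (x b y : V) : Prop where
  UH : U ≤ H
  HW : H ≤ W
  xH : x ∈ H
  xU : x ∉ U
  bH : b ∈ H
  bU : b ∉ U
  bxU : b + x ∉ U
  yW : y ∈ W
  yH : y ∉ H
  hyp : ∀ z ∈ W, z ∉ H → z + y ∈ H
  iff : ∀ w ∈ W, w ∈ E ↔ (w ∉ H ∨ w + x ∈ U)

theorem StrAt.step1 {E : Set V} (hI : FreeI E) (hF : FreeF E)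
    {W H U : Submodule (ZMod 2) V} {x b0 y0 : V} (S : StrAt E W H U x b0 y0)
    {v c y b : V} (hc : c ∈ H) (hyW : y ∈ W) (hyH : y ∉ H) (hvc : v + c ∉ E) (hvy : v + y ∉ E)
    (hb : b ∈ H) (hbU : b ∉ U) (hbx : b + x ∉ U) : v + c + b ∉ E := by
  intro h1
  have offH : ∀ h ∈ H, c + y + h ∈ E := by
    intro h hh
    refine (S.iff _ (add_mem (add_mem (S.HW hc) hyW) (S.HW hh))).2 (Or.inl ?_)
    intro h'
    have := (mem_add_left hc).1 ((Submodule.add_mem_iff_left H hh).1 h')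
    exact hyH this
  have xE : x ∈ E := (S.iff _ (S.HW S.xH)).2 (Or.inr (by rw [z2_self]; exact U.zero_mem))
  have bE : b ∉ E := fun h => by
    rcases (S.iff _ (S.HW hb)).1 h with h | h
    · exact h hb
    · exact hbx h
  have bxE : b + x ∉ E := fun h => by
    rcases (S.iff _ (S.HW (add_mem hb S.xH))).1 h with h | h
    · exact h (add_mem hb S.xH)
    · rw [add_assoc, z2_self, add_zero] at h; exact hbU h
  have e0 := offH 0 (zero_mem _)
  have ex := offH x S.xH
  have eb := offH b hb
  have ebx := offH (b + x) (add_mem hb S.xH)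
  -- B'(b) holds
  have h2 : v + y + b ∈ E := by
    by_contra h
    have := rule2 hI (c + y) (c + y + b) (v + c + b)
    simp only [add_comm, add_left_comm, add_assoc, z2_self, z2_left, add_zero, zero_add] at *
    tauto
  have h3 : v + c + b + x ∈ E → v + y + b + x ∈ E := by
    intro h' 
    by_contra h
    have := rule2 hI (c + y) (c + y + (b + x)) (v + c + (b + x))
    simp only [add_comm, add_left_comm, add_assoc, z2_self, z2_left, add_zero, zero_add] at *
    tauto
  have h3' : v + y + b + x ∈ E → v + c + b + x ∈ E := by
    intro h' 
    by_contra h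
    have := rule2 hI (c + y) (c + y + (b + x)) (v + y + (b + x))
    simp only [add_comm, add_left_comm, add_assoc, z2_self, z2_left, add_zero, zero_add] at *
    tauto
  have h4 : v + c + b + x ∉ E := by
    intro h
    have := rule3 hF (c + y) (c + y + x) (v + c + b)
    simp only [add_comm, add_left_comm, add_assoc, z2_self, z2_left, add_zero, zero_add] at *
    tauto
  have h5 : v + y + b + x ∉ E := fun h => h4 (h3' h)
  have h6 : v + y + x ∉ E := by
    intro h
    have := rule1 hI x (b + x) (v + y + b)
    simp only [add_comm, add_left_comm, add_assoc, z2_self, z2_left, add_zero, zero_add] at *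
    tauto
  have := rule2 hI (c + y + x) (c + y + (b + x)) (v + c + b)
  simp only [add_comm, add_left_comm, add_assoc, z2_self, z2_left, add_zero, zero_add] at *
  tauto

theorem StrAt.step2 {E : Set V} (hI : FreeI E) (hF : FreeF E)
    {W H U : Submodule (ZMod 2) V} {x b0 y0 : V} (S : StrAt E W H U x b0 y0)
    {v c y : V} (hv : v ∈ E) (hc : c ∈ H) (hyW : y ∈ W) (hyH : y ∉ H)
    (hvc : v + c ∉ E) (hvy : v + y ∉ E) : False := by
  by_cases h : c ∉ U ∧ c + x ∉ U
  · have := S.step1 hI hF hc hyW hyH hvc hvy hc h.1 h.2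
    rw [add_assoc, z2_self, add_zero] at this
    exact this hv
  · have h1 := S.step1 hI hF hc hyW hyH hvc hvy S.bH S.bU S.bxU
    rw [add_assoc] at h1
    have hcb : c + b0 ∉ U ∧ c + b0 + x ∉ U := by
      have : c ∈ U ∨ c + x ∈ U := by tauto
      rcases this with h | h
      · rw [add_assoc, mem_add_left h, mem_add_left h]
        exact ⟨S.bU, S.bxU⟩
      · have e1 : c + b0 = (c + x) + (b0 + x) := by
          simp only [add_comm, add_left_comm, add_assoc, z2_self, z2_left, add_zero, zero_add]
        have e2 : c + b0 + x = (c + x) + b0 := by abel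
        rw [e2, e1, mem_add_left h, mem_add_left h]
        exact ⟨S.bxU, S.bU⟩
    have := S.step1 hI hF (add_mem hc S.bH) hyW hyH h1 hvy (add_mem hc S.bH) hcb.1 hcb.2
    rw [add_assoc, z2_self, add_zero] at this
    exact this hv

theorem StrAt.lemP {E : Set V} (hI : FreeI E)
    {W H U : Submodule (ZMod 2) V} {x b0 y0 : V} (S : StrAt E W H U x b0 y0)
    {k : V} (hk : k ∈ E)
    (hno : ∀ h ∈ H, ∀ h' ∈ H, h' + x ∈ U → k + h ∈ E → k + h + h' ∉ E) :
    ∀ h ∈ H, k + h ∈ E ↔ h ∈ U := by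
  intro h hh
  have xE : x ∈ E := (S.iff _ (S.HW S.xH)).2 (Or.inr (by rw [z2_self]; exact U.zero_mem))
  have xx : x + x ∈ U := by rw [z2_self]; exact U.zero_mem
  have inE : ∀ h ∈ H, h ∈ E ↔ h + x ∈ U := fun h hh => by
    rw [S.iff h (S.HW hh)]; tauto
  have hkx := hno 0 H.zero_mem x S.xH xx (by simpa using hk)
  constructor
  · intro hkh
    by_contra hU
    have hx : h + x ∉ U := fun hx => hno 0 H.zero_mem h hh hx (by simpa using hk) (by simpa using hkh)
    have h1 := inE h hh
    have h2 := inE (h + x) (add_mem hh S.xH)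
    have h3 := hno h hh x S.xH xx hkh
    have := rule1 hI x h k
    simp only [add_comm, add_left_comm, add_assoc, z2_self, z2_left, add_zero, zero_add] at *
    tauto
  · intro hU
    by_contra hkh
    have h1 := inE h hh
    have h2 := inE (h + x) (add_mem hh S.xH)
    have hx : h + x ∉ U := by rw [mem_add_left hU]; exact S.xU
    have h3 := hno 0 H.zero_mem (h + x) (add_mem hh S.xH) (by
      rw [add_assoc, z2_self, add_zero]; exact hU) (by simpa using hk)
    have := rule2 hI x (h + x) k
    simp only [add_comm, add_left_comm, add_assoc, z2_self, z2_left, add_zero, zero_add] at *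
    tauto

theorem notmem_add {W : Submodule (ZMod 2) V} {v w : V} (hv : v ∉ W) (hw : w ∈ W) :
    v + w ∉ W := by rwa [Submodule.add_mem_iff_left W hw]

/-- builder, `H' = H + ⟨v+t⟩` and `U' = U` -/
theorem StrAt.build1 {E : Set V}
    {W H U : Submodule (ZMod 2) V} {x b0 y0 : V} (S : StrAt E W H U x b0 y0)
    {v t : V} (hv : v ∉ W) (ht : t ∈ W) (htH : t ∉ H)
    (hE : ∀ w ∈ W, v + w ∈ E ↔ w ∈ H) :
    StrAt E (W ⊔ Submodule.span (ZMod 2) {v}) (H ⊔ Submodule.span (ZMod 2) {v + t}) U x b0 y0 := by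
  have hWH : ∀ w ∈ W, w ∈ H ⊔ Submodule.span (ZMod 2) {v + t} ↔ w ∈ H := by
    intro w hw
    rw [mem_sup_sp]
    have : w + (v + t) ∉ H := fun h => notmem_add hv (add_mem hw ht) (by
      have := S.HW h
      rwa [show w + (v + t) = v + (w + t) by abel] at this)
    tauto
  have hdiff : ∀ z ∈ W, z ∉ H → ∀ z' ∈ W, z' ∉ H → z + z' ∈ H := by
    intro z hz hzH z' hz' hzH'
    have := add_mem (S.hyp z hz hzH) (S.hyp z' hz' hzH')
    rwa [show z + y0 + (z' + y0) = z + z' + (y0 + y0) by abel, z2_self, add_zero] at this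
  have hvH : ∀ w ∈ W, v + w ∈ H ⊔ Submodule.span (ZMod 2) {v + t} ↔ w ∉ H := by
    intro w hw
    rw [mem_sup_sp]
    have h1 : v + w ∉ H := fun h => notmem_add hv hw (S.HW h)
    have h2 : v + w + (v + t) = w + t := by
      simp only [add_comm, add_left_comm, add_assoc, z2_self, z2_left, add_zero, zero_add]
    rw [h2]
    constructor
    · rintro (h | h)
      · exact absurd h h1
      · intro hw; exact htH ((mem_add_left hw).1 h)
    · intro h; exact Or.inr (hdiff w hw h t ht htH)
  have hcase : ∀ z ∈ W ⊔ Submodule.span (ZMod 2) {v}, z ∈ W ∨ ∃ w ∈ W, z = v + w := by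
    intro z hz
    rcases mem_sup_sp.1 hz with h | h
    · exact Or.inl h
    · exact Or.inr ⟨z + v, h, by rw [add_comm z, z2_left]⟩
  refine ⟨S.UH.trans le_sup_left, ?_, Submodule.mem_sup_left S.xH, S.xU,
    Submodule.mem_sup_left S.bH, S.bU, S.bxU, Submodule.mem_sup_left S.yW, ?_, ?_, ?_⟩
  · refine sup_le (S.HW.trans le_sup_left) ?_
    rw [Submodule.span_singleton_le_iff_mem, mem_sup_sp]
    right
    rwa [show v + t + v = t + (v + v) by abel, z2_self, add_zero]
  · rw [hWH _ S.yW]; exact S.yH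
  · intro z hz hzH
    rcases hcase z hz with h | ⟨w, hw, rfl⟩
    · rw [hWH z h] at hzH
      exact Submodule.mem_sup_left (S.hyp z h hzH)
    · rw [hvH w hw, not_not] at hzH
      rw [add_assoc, hvH _ (add_mem hw S.yW), mem_add_left hzH]
      exact S.yH
  · intro z hz
    rcases hcase z hz with h | ⟨w, hw, rfl⟩
    · rw [hWH z h]; exact S.iff z h
    · rw [hvH w hw, hE w hw]
      have : v + w + x ∉ U := fun h => notmem_add hv (add_mem hw (S.HW S.xH)) (by
        rw [← add_assoc]; exact S.HW (S.UH h))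
      tauto

/-- builder, `H' = H + ⟨v+t⟩` and `U' = U + ⟨v+t+x⟩` -/
theorem StrAt.build2 {E : Set V}
    {W H U : Submodule (ZMod 2) V} {x b0 y0 : V} (S : StrAt E W H U x b0 y0)
    {v t : V} (hv : v ∉ W) (ht : t ∈ W)
    (hE : ∀ w ∈ W, v + w ∈ E ↔ (w + t ∉ H ∨ w + t ∈ U)) :
    StrAt E (W ⊔ Submodule.span (ZMod 2) {v}) (H ⊔ Submodule.span (ZMod 2) {v + t})
      (U ⊔ Submodule.span (ZMod 2) {v + t + x}) x b0 y0 := by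
  have gW : ∀ (P : Submodule (ZMod 2) V), P ≤ W → ∀ t ∈ W, ∀ w ∈ W,
      w ∈ P ⊔ Submodule.span (ZMod 2) {v + t} ↔ w ∈ P := by
    intro P hP t ht w hw
    rw [mem_sup_sp]
    have : w + (v + t) ∉ P := fun h => notmem_add hv (add_mem hw ht) (by
      have := hP h
      rwa [show w + (v + t) = v + (w + t) by abel] at this)
    tauto
  have gv : ∀ (P : Submodule (ZMod 2) V), P ≤ W → ∀ t ∈ W, ∀ w ∈ W,
      v + w ∈ P ⊔ Submodule.span (ZMod 2) {v + t} ↔ w + t ∈ P := by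
    intro P hP t ht w hw
    rw [mem_sup_sp]
    have h1 : v + w ∉ P := fun h => notmem_add hv hw (hP h)
    have h2 : v + w + (v + t) = w + t := by
      simp only [add_comm, add_left_comm, add_assoc, z2_self, z2_left, add_zero, zero_add]
    rw [h2]; tauto
  have UW := S.UH.trans S.HW
  have xW := S.HW S.xH
  have hcase : ∀ z ∈ W ⊔ Submodule.span (ZMod 2) {v}, z ∈ W ∨ ∃ w ∈ W, z = v + w := by
    intro z hz
    rcases mem_sup_sp.1 hz with h | h
    · exact Or.inl h
    · exact Or.inr ⟨z + v, h, by rw [add_comm z, z2_left]⟩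
  rw [add_assoc]
  refine ⟨?_, ?_, Submodule.mem_sup_left S.xH, ?_,
    Submodule.mem_sup_left S.bH, ?_, ?_, Submodule.mem_sup_left S.yW, ?_, ?_, ?_⟩
  · refine sup_le (S.UH.trans le_sup_left) ?_
    rw [Submodule.span_singleton_le_iff_mem, gv H S.HW t ht _ (add_mem ht xW)]
    rw [show t + x + t = x + (t + t) by abel, z2_self, add_zero]
    exact S.xH
  · refine sup_le (S.HW.trans le_sup_left) ?_
    rw [Submodule.span_singleton_le_iff_mem, mem_sup_sp]
    right
    rwa [show v + t + v = t + (v + v) by abel, z2_self, add_zero]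
  · rw [gW U UW _ (add_mem ht xW) _ xW]; exact S.xU
  · rw [gW U UW _ (add_mem ht xW) _ (S.HW S.bH)]; exact S.bU
  · rw [gW U UW _ (add_mem ht xW) _ (add_mem (S.HW S.bH) xW)]; exact S.bxU
  · rw [gW H S.HW _ ht _ S.yW]; exact S.yH
  · intro z hz hzH
    rcases hcase z hz with h | ⟨w, hw, rfl⟩
    · rw [gW H S.HW _ ht z h] at hzH
      exact Submodule.mem_sup_left (S.hyp z h hzH)
    · rw [gv H S.HW _ ht w hw] at hzH
      rw [add_assoc, gv H S.HW _ ht _ (add_mem hw S.yW)]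
      have := S.hyp _ (add_mem hw ht) hzH
      rwa [add_right_comm] at this
  · intro z hz
    rcases hcase z hz with h | ⟨w, hw, rfl⟩
    · rw [gW H S.HW _ ht z h, gW U UW _ (add_mem ht xW) _ (add_mem h xW)]; exact S.iff z h
    · rw [gv H S.HW _ ht w hw, hE w hw, add_assoc, gv U UW _ (add_mem ht xW) _ (add_mem hw xW)]
      rw [show w + x + (t + x) = w + t + (x + x) by abel, z2_self, add_zero]

theorem StrAt.extend {E : Set V} (hI : FreeI E) (hF : FreeF E)
    {W H U : Submodule (ZMod 2) V} {x b0 y0 : V} (S : StrAt E W H U x b0 y0)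
    {v : V} (hv : v ∈ E) (hvW : v ∉ W) :
    ∃ H' U', StrAt E (W ⊔ Submodule.span (ZMod 2) {v}) H' U' x b0 y0 := by
  have hdiff : ∀ z ∈ W, z ∉ H → ∀ z' ∈ W, z' ∉ H → z + z' ∈ H := by
    intro z hz hzH z' hz' hzH'
    have := add_mem (S.hyp z hz hzH) (S.hyp z' hz' hzH')
    rwa [show z + y0 + (z' + y0) = z + z' + (y0 + y0) by abel, z2_self, add_zero] at this
  have offE : ∀ w ∈ W, w ∉ H → w ∈ E := fun w hw h => (S.iff w hw).2 (Or.inl h)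
  have xE : ∀ h ∈ H, h + x ∈ U → h ∈ E := fun h hh hx => (S.iff h (S.HW hh)).2 (Or.inr hx)
  by_cases hB : ∀ y ∈ W, y ∉ H → v + y ∈ E
  · have hno : ∀ h ∈ H, ∀ h' ∈ H, h' + x ∈ U → v + h ∈ E → v + h + h' ∉ E := by
      intro h hh h' hh' hx h1 h2
      have n1 : ∀ h ∈ H, y0 + h ∉ H := fun h hh => notmem_add S.yH hh
      have n2 : ∀ h ∈ H, y0 + h ∈ W := fun h hh => add_mem S.yW (S.HW hh)
      have a1 := offE _ (n2 h hh) (n1 h hh)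
      have a2 := offE _ (n2 _ (add_mem hh hh')) (n1 _ (add_mem hh hh'))
      have a3 := hB _ S.yW S.yH
      have a4 := hB _ (n2 h' hh') (n1 h' hh')
      have a5 := xE h' hh' hx
      have := rule3 hF (y0 + h) (y0 + (h + h')) (v + h)
      simp only [add_comm, add_left_comm, add_assoc, z2_self, z2_left, add_zero, zero_add] at *
      tauto
    have key := S.lemP hI hv hno
    refine ⟨_, _, S.build2 (t := 0) hvW (zero_mem _) ?_⟩
    intro w hw
    rw [add_zero]
    by_cases hwH : w ∈ H
    · rw [key w hwH]; tauto
    · have := hB w hw hwH; tauto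
  · push Not at hB
    obtain ⟨y, hyW, hyH, hvy⟩ := hB
    have hA : ∀ c ∈ H, v + c ∈ E := by
      intro c hc
      by_contra h
      exact S.step2 hI hF hv hc hyW hyH h hvy
    by_cases hB' : ∃ y1 ∈ W, y1 ∉ H ∧ v + y1 ∈ E
    · obtain ⟨y1, h1W, h1H, hvy1⟩ := hB'
      have hno : ∀ h ∈ H, ∀ h' ∈ H, h' + x ∈ U → v + y1 + h ∈ E → v + y1 + h + h' ∉ E := by
        intro h hh h' hh' hx h1 h2
        have n1 : ∀ h ∈ H, y1 + h ∉ H := fun h hh => notmem_add h1H hh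
        have n2 : ∀ h ∈ H, y1 + h ∈ W := fun h hh => add_mem h1W (S.HW hh)
        have a1 := offE _ (n2 h hh) (n1 h hh)
        have a2 := offE _ (n2 _ (add_mem hh hh')) (n1 _ (add_mem hh hh'))
        have a4 := hA h' hh'
        have a5 := xE h' hh' hx
        have := rule3 hF (y1 + h) (y1 + (h + h')) v
        simp only [add_comm, add_left_comm, add_assoc, z2_self, z2_left, add_zero, zero_add] at *
        tauto
      have key := S.lemP hI hvy1 hno
      refine ⟨_, _, S.build2 (t := y1) hvW h1W ?_⟩
      intro w hw
      by_cases hwH : w ∈ H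
      · have : w + y1 ∉ H := by rwa [mem_add_left hwH]
        have := hA w hwH
        tauto
      · have h1 := hdiff w hw hwH y1 h1W h1H
        have := key _ h1
        rw [show v + y1 + (w + y1) = v + w + (y1 + y1) by abel, z2_self, add_zero] at this
        rw [this]; tauto
    · push Not at hB'
      refine ⟨_, _, S.build1 (t := y0) hvW S.yW S.yH ?_⟩
      intro w hw
      by_cases hwH : w ∈ H
      · have := hA w hwH; tauto
      · have := hB' w hw hwH; tauto

end Generic
section Parity

variable {V : Type*} [AddCommGroup V] [Module (ZMod 2) V]

/-- the third derivative at the origin -/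
def T3 (f : V → ZMod 2) (a b c : V) : ZMod 2 :=
  f a + f b + f c + f (a + b) + f (a + c) + f (b + c) + f (a + (b + c))

theorem T3_comm12 (f : V → ZMod 2) (a b c : V) : T3 f a b c = T3 f b a c := by
  unfold T3
  simp only [add_comm (G := V), add_left_comm (G := V), add_assoc (G := V)]
  ring

theorem T3_comm23 (f : V → ZMod 2) (a b c : V) : T3 f a b c = T3 f a c b := by
  unfold T3
  simp only [add_comm (G := V), add_left_comm (G := V), add_assoc (G := V)]
  ring

theorem T3_cocycle (f : V → ZMod 2) (a b c d : V) :
    T3 f a b (c + d) = T3 f a b c + T3 f a b d + T3 f (a + b) c d + T3 f a c d + T3 f b c d := by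
  unfold T3
  simp only [add_comm (G := V), add_left_comm (G := V), add_assoc (G := V)]
  grind

theorem span_ind {E : Set V} (hE : Submodule.span (ZMod 2) E = ⊤) {P : V → Prop} (h0 : P 0)
    (hadd : ∀ p e, P p → e ∈ E → P (p + e)) (v : V) : P v := by
  have hv : v ∈ Submodule.span (ZMod 2) E := by rw [hE]; trivial
  have : ∀ p, P p → P (p + v) := by
    induction hv using Submodule.span_induction with
    | mem x h => exact fun p hp => hadd p x hp h
    | zero => intro p hp; simpa using hp
    | add x y _ _ hx hy => intro p hp; rw [← add_assoc]; exact hy _ (hx p hp)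
    | smul c x _ hx =>
      intro p hp
      rcases (by decide : ∀ c : ZMod 2, c = 0 ∨ c = 1) c with rfl | rfl
      · simpa using hp
      · simpa using hx p hp
  simpa using this 0 h0

theorem T3_zero (f : V → ZMod 2) (f0 : f 0 = 0) (a b : V) : T3 f a b 0 = 0 := by
  unfold T3
  simp only [add_zero, f0]
  grind

theorem T3_all {f : V → ZMod 2} (f0 : f 0 = 0)
    (hspan : Submodule.span (ZMod 2) {v | f v = 1} = ⊤)
    (hT : ∀ a b c, f a = 1 → f b = 1 → f c = 1 → T3 f a b c = 0) (a b c : V) :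
    T3 f a b c = 0 := by
  have s1 : ∀ p a b, f a = 1 → f b = 1 → T3 f a b p = 0 := by
    refine span_ind hspan (fun a b _ _ => T3_zero f f0 a b) ?_
    intro p e hp he a b ha hb
    have he : f e = 1 := he
    have c1 := T3_cocycle f a b e p
    have c2 := T3_cocycle f a e b p
    have c3 := T3_cocycle f b e a p
    have t0 := hT a b e ha hb he
    have t1 := hp a b ha hb
    have t2 := hp a e ha he
    have t3 := hp b e hb he
    by_cases h1 : f (a + b) = 1
    · have t4 := hp (a + b) e h1 he
      rw [add_comm p e]; grind
    by_cases h2 : f (a + e) = 1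
    · have t4 := hp (a + e) b h2 hb
      have : T3 f a b (e + p) = T3 f a e (b + p) + T3 f a b p + T3 f a e p := by
        unfold T3
        simp only [add_comm (G := V), add_left_comm (G := V), add_assoc (G := V)]
        grind
      have t5 := hT a e b ha he hb
      have t6 := hp e b he hb
      rw [add_comm p e]; grind
    by_cases h3 : f (b + e) = 1
    · have t4 := hp (b + e) a h3 ha
      have : T3 f a b (e + p) = T3 f b e (a + p) + T3 f a b p + T3 f b e p := by
        unfold T3
        simp only [add_comm (G := V), add_left_comm (G := V), add_assoc (G := V)]
        grind
      have t5 := hT b e a hb he ha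
      have t6 := hp e a he ha
      rw [add_comm p e]; grind
    have z : ∀ c : ZMod 2, c ≠ 1 → c = 0 := by decide
    replace h1 := z _ h1
    replace h2 := z _ h2
    replace h3 := z _ h3
    have hs : f (a + (b + e)) = 1 := by
      unfold T3 at t0
      grind
    have t7 := hp (a + (b + e)) e hs he
    clear c1 c2 c3 hp hT
    unfold T3 at *
    simp only [add_comm (G := V), add_left_comm (G := V), add_assoc (G := V), z2_self (V := V),
      z2_left (V := V), add_zero, zero_add] at *
    grind
  have s2 : ∀ q a p, f a = 1 → T3 f a q p = 0 := by
    refine span_ind hspan (fun a b _ => by rw [T3_comm23]; exact T3_zero f f0 _ _) ?_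
    intro q e hq he a p ha
    have he : f e = 1 := he
    have c1 := T3_cocycle f a p q e
    have k1 : T3 f a p q = 0 := by rw [T3_comm23]; exact hq a p ha
    have k2 : T3 f a p e = 0 := by rw [T3_comm23]; exact s1 p a e ha he
    have k3 : ∀ z, T3 f z q e = 0 := fun z => by
      rw [T3_comm23, T3_comm12, T3_comm23]; exact hq e z he
    rw [T3_comm23, c1, k1, k2, k3, k3, k3]
    simp
  have s3 : ∀ r q p, T3 f r q p = 0 := by
    refine span_ind hspan (fun a b => by
      rw [T3_comm12, T3_comm23]; exact T3_zero f f0 _ _) ?_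
    intro r e hr he q p
    have he : f e = 1 := he
    rw [T3_comm12, T3_comm23, T3_cocycle, T3_comm23 f q p r, T3_comm12 f q r, hr,
      T3_comm23 f q p e, T3_comm12 f q e, s2 q e p he, T3_comm12 f (q + p), hr,
      T3_comm12 f q, hr, T3_comm12 f p, hr]
    simp
  exact s3 a b c

end Parity
section Base

variable {V : Type*} [AddCommGroup V] [Module (ZMod 2) V]

theorem add_eq_zero_z2 {u v : V} : u + v = 0 ↔ u = v := by
  constructor
  · intro h
    have : u + v + v = v := by rw [h, zero_add]
    rwa [add_assoc, z2_self, add_zero] at this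
  · rintro rfl; exact z2_self u

theorem StrAt.base {E : Set V} (E0 : 0 ∉ E) {p q r : V} (hp : p ∉ E) (hq : q ∉ E)
    (hpq : p + q ∈ E) (hr : r ∈ E) (hrp : r + p ∈ E) (hrq : r + q ∈ E) (hrpq : r + (p + q) ∈ E) :
    ∃ W H U x b y, StrAt E W H U x b y := by
  obtain ⟨H, hH⟩ : ∃ H : Submodule (ZMod 2) V, ∀ u, u ∈ H ↔ u = 0 ∨ u = p ∨ u = q ∨ u = p + q := by
    refine ⟨⊥ ⊔ Submodule.span (ZMod 2) {p} ⊔ Submodule.span (ZMod 2) {q}, fun u => ?_⟩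
    rw [mem_sup_sp, mem_sup_sp, mem_sup_sp, Submodule.mem_bot, Submodule.mem_bot,
      Submodule.mem_bot, Submodule.mem_bot, add_eq_zero_z2, add_eq_zero_z2, add_assoc,
      add_eq_zero_z2, add_comm q p]
    tauto
  have hp0 : p ≠ 0 := by rintro rfl; rw [zero_add] at hpq; exact hq hpq
  have hq0 : q ≠ 0 := by rintro rfl; rw [add_zero] at hpq; exact hp hpq
  have hpq0 : p + q ≠ 0 := by intro h; rw [h] at hpq; exact E0 hpq
  have hrH : r ∉ H := by
    rw [hH]
    rintro (rfl | rfl | rfl | rfl)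
    · exact E0 hr
    · exact hp hr
    · exact hq hr
    · apply hq
      simpa only [add_comm, add_left_comm, add_assoc, z2_self, z2_left, add_zero, zero_add] using hrp
  refine ⟨H ⊔ Submodule.span (ZMod 2) {r}, H, ⊥, p + q, p, r, bot_le, le_sup_left, ?_, ?_, ?_, ?_,
    ?_, ?_, hrH, ?_, ?_⟩
  · rw [hH]; tauto
  · simpa using hpq0
  · rw [hH]; tauto
  · simpa using hp0
  · rw [z2_left]; simpa using hq0
  · rw [mem_sup_sp, z2_self]; right; exact zero_mem _
  · intro z hz hzH
    rcases mem_sup_sp.1 hz with h | h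
    · exact absurd h hzH
    · exact h
  · intro w hw
    rw [Submodule.mem_bot, add_eq_zero_z2]
    rcases mem_sup_sp.1 hw with h | h
    · have h' := (hH w).1 h
      constructor
      · intro hE
        right
        rcases h' with rfl | rfl | rfl | rfl
        · exact absurd hE E0
        · exact absurd hE hp
        · exact absurd hE hq
        · rfl
      · rintro (h1 | rfl)
        · exact absurd h h1
        · exact hpq
    · have hwH : w ∉ H := fun hw' => hrH ((mem_add_left hw').1 h)
      have hw : w = r + (w + r) := by
        simp only [add_comm, add_left_comm, add_assoc, z2_self, z2_left, add_zero, zero_add]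
      have : w ∈ E := by
        rw [hw]
        rcases (hH _).1 h with h' | h' | h' | h' <;> rw [h']
        · rwa [add_zero]
        · exact hrp
        · exact hrq
        · exact hrpq
      tauto

open Classical in
theorem StrAt.of_T3 {E : Set V} (E0 : 0 ∉ E) (hI : FreeI E) (hF : FreeF E) {a b c : V}
    (ha : a ∈ E) (hb : b ∈ E) (hc : c ∈ E)
    (h : T3 (fun v => if v ∈ E then (1 : ZMod 2) else 0) a b c ≠ 0) :
    ∃ W H U x b y, StrAt E W H U x b y := by
  have h1 := hI a b c ha hb hc
  have h2 := hF a b c ha hb hc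
  have k1 := @StrAt.base V _ _ E E0 (a + b) (a + c) a
  have k2 := @StrAt.base V _ _ E E0 (a + b) (b + c) b
  have k3 := @StrAt.base V _ _ E E0 (a + c) (b + c) c
  have k4 := @StrAt.base V _ _ E E0 (a + b) (a + (b + c)) a
  have k5 := @StrAt.base V _ _ E E0 (a + c) (a + (b + c)) a
  have k6 := @StrAt.base V _ _ E E0 (b + c) (a + (b + c)) b
  unfold T3 at h
  simp only [ha, hb, hc, if_true] at h
  simp only [add_comm (G := V), add_left_comm (G := V), add_assoc (G := V), z2_self (V := V),
      z2_left (V := V), add_zero (M := V), zero_add (M := V)] at *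
  by_cases e1 : a + b ∈ E <;> by_cases e2 : a + c ∈ E <;> by_cases e3 : b + c ∈ E <;>
    by_cases e4 : a + (b + c) ∈ E <;>
    simp only [e1, e2, e3, e4, if_true, if_false] at h <;>
    first
    | exact absurd (by decide) h
    | (exfalso; apply h1 <;> assumption)
    | (exfalso; apply h2 <;> assumption)
    | (apply k1 <;> assumption)
    | (apply k2 <;> assumption)
    | (apply k3 <;> assumption)
    | (apply k4 <;> assumption)
    | (apply k5 <;> assumption)
    | (apply k6 <;> assumption)

end Base

section Even

variable {n : ℕ}

open Classical in
/-- sum over a subspace -/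
noncomputable def subSum (W : Submodule (ZMod 2) (Fin n → ZMod 2))
    (F : (Fin n → ZMod 2) → ZMod 2) : ZMod 2 :=
  ∑ v ∈ Finset.univ.filter (fun v => v ∈ W), F v

theorem subSum_split (W : Submodule (ZMod 2) (Fin n → ZMod 2)) (k : ℕ)
    (hk : k + 1 ≤ Module.finrank (ZMod 2) W) (F : (Fin n → ZMod 2) → ZMod 2) :
    ∃ K : Submodule (ZMod 2) (Fin n → ZMod 2), ∃ w : Fin n → ZMod 2,
      k ≤ Module.finrank (ZMod 2) K ∧ subSum W F = subSum K (fun v => F v + F (v + w)) := by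
  classical
  have hW : W ≠ ⊥ := by
    rintro rfl
    simp at hk
  obtain ⟨w, hw, w0⟩ := Submodule.exists_mem_ne_zero_of_ne_bot hW
  obtain ⟨i, hi⟩ := Function.ne_iff.1 w0
  have z : ∀ c : ZMod 2, c ≠ 0 → c = 1 := by decide
  have z' : ∀ c : ZMod 2, c ≠ 0 → c + 1 = 0 := by decide
  have hi1 : w i = 1 := z _ hi
  have memK : ∀ v, v ∈ W ⊓ LinearMap.ker (LinearMap.proj i : (Fin n → ZMod 2) →ₗ[ZMod 2] ZMod 2) ↔
      v ∈ W ∧ v i = 0 := by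
    intro v; simp [Submodule.mem_inf, LinearMap.mem_ker]
  refine ⟨W ⊓ LinearMap.ker (LinearMap.proj i : (Fin n → ZMod 2) →ₗ[ZMod 2] ZMod 2), w, ?_, ?_⟩
  · generalize hK : W ⊓ LinearMap.ker (LinearMap.proj i : (Fin n → ZMod 2) →ₗ[ZMod 2] ZMod 2) = K
    rw [hK] at memK
    have hwK : w ∉ K := fun h => hi ((memK w).1 h).2
    have hle : W ≤ K ⊔ Submodule.span (ZMod 2) {w} := by
      intro v hv
      rw [mem_sup_sp, memK, memK]
      by_cases h : v i = 0
      · exact Or.inl ⟨hv, h⟩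
      · exact Or.inr ⟨add_mem hv hw, by rw [Pi.add_apply, hi1]; exact z' _ h⟩
    have h1 := Submodule.finrank_mono hle
    rw [Submodule.finrank_sup_span_singleton hwK] at h1
    omega
  · unfold subSum
    rw [Finset.sum_add_distrib, ← Finset.sum_filter_add_sum_filter_not _ (fun v => v i = 0)]
    congr 1
    · refine Finset.sum_congr ?_ (fun _ _ => rfl)
      ext v
      simp only [Finset.mem_filter, Finset.mem_univ, true_and, memK]
    · refine Finset.sum_bij' (fun v _ => v + w) (fun v _ => v + w) ?_ ?_ ?_ ?_ ?_
      · intro v hv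
        simp only [Finset.mem_filter, Finset.mem_univ, true_and, memK] at hv ⊢
        exact ⟨add_mem hv.1 hw, by rw [Pi.add_apply, hi1]; exact z' _ hv.2⟩
      · intro v hv
        simp only [Finset.mem_filter, Finset.mem_univ, true_and, memK] at hv ⊢
        exact ⟨add_mem hv.1 hw, by rw [Pi.add_apply, hi1, hv.2]; decide⟩
      · intro v _; rw [add_assoc, z2_self, add_zero]
      · intro v _; rw [add_assoc, z2_self, add_zero]
      · intro v _; rw [add_assoc, z2_self, add_zero]

theorem subSum_eq_zero {f : (Fin n → ZMod 2) → ZMod 2} (hT : ∀ a b c, T3 f a b c = 0)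
    (W : Submodule (ZMod 2) (Fin n → ZMod 2)) (hk : 3 ≤ Module.finrank (ZMod 2) W) :
    subSum W f = 0 := by
  obtain ⟨K, a, hK, e1⟩ := subSum_split W 2 hk f
  obtain ⟨K2, b, hK2, e2⟩ := subSum_split K 1 hK (fun v => f v + f (v + a))
  obtain ⟨K3, c, hK3, e3⟩ := subSum_split K2 0 hK2
    (fun v => (f v + f (v + a)) + (f (v + b) + f (v + b + a)))
  rw [e1, e2, e3]
  unfold subSum
  refine Finset.sum_eq_zero fun v _ => ?_
  have t1 := hT a b (v + c)
  have t2 := hT a b v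
  have t3 := hT a b c
  have t4 := hT v c a
  have t5 := hT v c b
  have t6 := hT v c (a + b)
  unfold T3 at *
  simp only [add_comm (G := Fin n → ZMod 2), add_left_comm (G := Fin n → ZMod 2),
    add_assoc (G := Fin n → ZMod 2)] at *
  grind

theorem even_of_T3 {E : Set (Fin n → ZMod 2)} (E0 : 0 ∉ E) {f : (Fin n → ZMod 2) → ZMod 2}
    (hf : ∀ v, f v = 1 ↔ v ∈ E) (hT : ∀ a b c, T3 f a b c = 0)
    (W : Submodule (ZMod 2) (Fin n → ZMod 2)) (hk : 3 ≤ Module.finrank (ZMod 2) W) :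
    Even (E ∩ ((W : Set (Fin n → ZMod 2)) \ {0})).ncard := by
  classical
  have h := subSum_eq_zero hT W hk
  have hf' : ∀ v, f v = if v ∈ E then 1 else 0 := by
    intro v
    by_cases hv : v ∈ E
    · rw [if_pos hv, hf]; exact hv
    · rw [if_neg hv]
      exact (by decide : ∀ c : ZMod 2, c ≠ 1 → c = 0) _ (fun h => hv ((hf v).1 h))
  have e : E ∩ ((W : Set (Fin n → ZMod 2)) \ {0}) =
      ((Finset.univ.filter (fun v => v ∈ W)).filter (fun v => v ∈ E) : Finset (Fin n → ZMod 2)) := by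
    ext v
    simp only [Set.mem_inter_iff, Set.mem_sdiff, SetLike.mem_coe, Set.mem_singleton_iff,
      Finset.coe_filter, Finset.mem_filter, Finset.mem_univ, true_and, Set.mem_ofPred_eq]
    constructor
    · tauto
    · rintro ⟨h1, h2⟩; exact ⟨h2, h1, fun h => E0 (h ▸ h2)⟩
  rw [e, Set.ncard_coe_finset, ← ZMod.natCast_eq_zero_iff_even, ← h]
  unfold subSum
  simp only [hf']
  rw [Finset.sum_boole]

end Even
section Conv

theorem hasIR_iff (M N : BinMatroid) : M.HasIR N ↔
    ∃ φ : (Fin N.dim → ZMod 2) →ₗ[ZMod 2] (Fin M.dim → ZMod 2),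
      Function.Injective φ ∧ ∀ v, v ∈ N.E ↔ φ v ∈ M.E := by
  constructor
  · rintro ⟨φ, hφ, h⟩
    refine ⟨φ, hφ, fun v => ⟨fun hv => ?_, fun hv => ?_⟩⟩
    · have : φ v ∈ φ '' N.E := ⟨v, hv, rfl⟩
      rw [h] at this
      exact this.1
    · have : φ v ∈ M.E ∩ (Set.range φ \ {0}) :=
        ⟨hv, ⟨v, rfl⟩, fun h0 => M.zero_not_mem (by
          rw [Set.mem_singleton_iff] at h0; rwa [h0] at hv)⟩
      rw [← h] at this
      obtain ⟨u, hu, e⟩ := this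
      rwa [← hφ e]
  · rintro ⟨φ, hφ, h⟩
    refine ⟨φ, hφ, ?_⟩
    ext u
    constructor
    · rintro ⟨v, hv, rfl⟩
      have h1 := (h v).1 hv
      refine ⟨h1, ⟨v, rfl⟩, fun h0 => M.zero_not_mem ?_⟩
      rw [Set.mem_singleton_iff] at h0
      rwa [h0] at h1
    · rintro ⟨h1, ⟨v, rfl⟩, _⟩
      exact ⟨v, (h v).2 h1, rfl⟩

theorem cases3 : ∀ v : Fin 3 → ZMod 2, v = 0 ∨ v = ![1, 0, 0] ∨ v = ![0, 1, 0] ∨ v = ![0, 0, 1] ∨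
    v = ![1, 1, 0] ∨ v = ![1, 0, 1] ∨ v = ![0, 1, 1] ∨ v = ![1, 1, 1] := by
  decide

theorem emb3 {V : Type*} [AddCommGroup V] [Module (ZMod 2) V] {E : Set V} (E0 : 0 ∉ E)
    {D : Set (Fin 3 → ZMod 2)} (D0 : 0 ∉ D) (a b c : V) (n1 : a ≠ 0) (n2 : b ≠ 0) (n3 : c ≠ 0)
    (n4 : a + b ≠ 0) (n5 : a + c ≠ 0) (n6 : b + c ≠ 0) (n7 : a + (b + c) ≠ 0)
    (i1 : ![1, 0, 0] ∈ D ↔ a ∈ E) (i2 : ![0, 1, 0] ∈ D ↔ b ∈ E) (i3 : ![0, 0, 1] ∈ D ↔ c ∈ E)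
    (i4 : ![1, 1, 0] ∈ D ↔ a + b ∈ E) (i5 : ![1, 0, 1] ∈ D ↔ a + c ∈ E)
    (i6 : ![0, 1, 1] ∈ D ↔ b + c ∈ E) (i7 : ![1, 1, 1] ∈ D ↔ a + (b + c) ∈ E) :
    ∃ φ : (Fin 3 → ZMod 2) →ₗ[ZMod 2] V, Function.Injective φ ∧ ∀ v, v ∈ D ↔ φ v ∈ E := by
  obtain ⟨φ, hφ⟩ : ∃ φ : (Fin 3 → ZMod 2) →ₗ[ZMod 2] V,
      ∀ v, φ v = v 0 • a + (v 1 • b + v 2 • c) := by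
    refine ⟨(LinearMap.proj 0 : (Fin 3 → ZMod 2) →ₗ[ZMod 2] ZMod 2).smulRight a +
      ((LinearMap.proj 1 : (Fin 3 → ZMod 2) →ₗ[ZMod 2] ZMod 2).smulRight b +
      (LinearMap.proj 2 : (Fin 3 → ZMod 2) →ₗ[ZMod 2] ZMod 2).smulRight c), fun v => ?_⟩
    simp
  refine ⟨φ, ?_, ?_⟩
  · rw [← LinearMap.ker_eq_bot, LinearMap.ker_eq_bot']
    intro v hv
    rw [hφ] at hv
    rcases cases3 v with h | h | h | h | h | h | h | h <;> subst h <;> simp at hv <;>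
      first
      | rfl
      | (exfalso; tauto)
  · intro v
    rcases cases3 v with h | h | h | h | h | h | h | h <;> rw [h]
    · rw [map_zero]; exact ⟨fun h => absurd h D0, fun h => absurd h E0⟩
    · rw [i1, hφ]; simp
    · rw [i2, hφ]; simp
    · rw [i3, hφ]; simp
    · rw [i4, hφ]; simp
    · rw [i5, hφ]; simp
    · rw [i6, hφ]; simp
    · rw [i7, hφ]; simp

theorem mem_I3 (v : Fin 3 → ZMod 2) :
    v ∈ I3.E ↔ (v = ![1, 0, 0] ∨ v = ![0, 1, 0] ∨ v = ![0, 0, 1]) := by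
  have h : ∀ v : Fin 3 → ZMod 2, (∃ i : Fin 3, (Pi.single i 1 : Fin 3 → ZMod 2) = v) ↔
      (v = ![1, 0, 0] ∨ v = ![0, 1, 0] ∨ v = ![0, 0, 1]) := by decide
  exact h v

theorem mem_F7 (v : Fin 3 → ZMod 2) : v ∈ F7.E ↔ v ≠ 0 := Iff.rfl

theorem not_I3 {V : Type*} [AddCommGroup V] [Module (ZMod 2) V] {E : Set V} (h : FreeI E)
    (φ : (Fin 3 → ZMod 2) →ₗ[ZMod 2] V)
    (k : ∀ v, φ v ∈ E ↔ (v = ![1, 0, 0] ∨ v = ![0, 1, 0] ∨ v = ![0, 0, 1])) : False := by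
  have a1 := h (φ ![1, 0, 0]) (φ ![0, 1, 0]) (φ ![0, 0, 1])
  rw [← map_add, ← map_add, ← map_add, ← map_add] at a1
  apply a1 <;> rw [k] <;> decide

theorem not_F7 {V : Type*} [AddCommGroup V] [Module (ZMod 2) V] {E : Set V} (h : FreeF E)
    (φ : (Fin 3 → ZMod 2) →ₗ[ZMod 2] V) (k : ∀ v, φ v ∈ E ↔ v ≠ 0) : False := by
  have a1 := h (φ ![1, 0, 0]) (φ ![0, 1, 0]) (φ ![0, 0, 1])
  rw [← map_add, ← map_add, ← map_add, ← map_add] at a1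
  apply a1 <;> rw [k] <;> decide

theorem freeI_iff (M : BinMatroid) : ¬ M.HasIR I3 ↔ FreeI M.E := by
  rw [hasIR_iff]
  have E0 := M.zero_not_mem
  constructor
  · intro h a b c ha hb hc hab hac hbc habc
    apply h
    refine emb3 (D := I3.E) E0 I3.zero_not_mem a b c ?_ ?_ ?_ ?_ ?_ ?_ ?_ ?_ ?_ ?_ ?_ ?_ ?_ ?_
    · rintro rfl; exact E0 ha
    · rintro rfl; exact E0 hb
    · rintro rfl; exact E0 hc
    · intro h; rw [add_eq_zero_z2] at h; subst h; rw [z2_left] at habc; exact habc hc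
    · intro h; rw [add_eq_zero_z2] at h; subst h; rw [add_comm b, z2_left] at habc; exact habc hb
    · intro h; rw [h, add_zero] at habc; exact habc ha
    · intro h; rw [add_eq_zero_z2] at h; rw [h] at ha; exact hbc ha
    all_goals
      erw [mem_I3]
      simp [*]
  · rintro h ⟨φ, _, hφ⟩
    exact not_I3 h φ fun v => (hφ v).symm.trans (mem_I3 v)

theorem freeF_iff (M : BinMatroid) : ¬ M.HasIR F7 ↔ FreeF M.E := by
  rw [hasIR_iff]
  have E0 := M.zero_not_mem
  constructor
  · intro h a b c ha hb hc hab hac hbc habc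
    have ne : ∀ v ∈ M.E, v ≠ 0 := by rintro v hv rfl; exact E0 hv
    apply h
    refine emb3 (D := F7.E) E0 F7.zero_not_mem a b c (ne _ ha) (ne _ hb) (ne _ hc) (ne _ hab)
      (ne _ hac) (ne _ hbc) (ne _ habc) ?_ ?_ ?_ ?_ ?_ ?_ ?_
    all_goals
      erw [mem_F7]
      simp [*]
  · rintro h ⟨φ, _, hφ⟩
    exact not_F7 h φ fun v => (hφ v).symm.trans (mem_F7 v)

theorem ncard_of_dec {D : Set (Fin 3 → ZMod 2)} {p : (Fin 3 → ZMod 2) → Prop} [DecidablePred p]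
    (h : ∀ v, v ∈ D ↔ p v) : D.ncard = (Finset.univ.filter p).card := by
  have : D = ((Finset.univ.filter p : Finset (Fin 3 → ZMod 2)) : Set (Fin 3 → ZMod 2)) := by
    ext v
    rw [Finset.mem_coe, Finset.mem_filter, h]
    simp
  rw [this, Set.ncard_coe_finset]

theorem ncard_I3 : I3.E.ncard = 3 :=
  (ncard_of_dec mem_I3).trans (by decide)

theorem ncard_F7 : F7.E.ncard = 7 :=
  (ncard_of_dec mem_F7).trans (by decide)

theorem memE_not {M N : BinMatroid} (hM : M.MemE 3) (hN : N.dim = 3) (hodd : ¬ Even N.E.ncard) :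
    ¬ M.HasIR N := by
  rintro ⟨φ, hφ, h⟩
  apply hodd
  have := hM (LinearMap.range φ) (by
    rw [LinearMap.finrank_range_of_inj hφ, Module.finrank_fin_fun, hN])
  rw [LinearMap.coe_range, ← h, Set.ncard_image_of_injective _ hφ] at this
  exact this

theorem transferI {V V₀ : Type*} [AddCommGroup V] [AddCommGroup V₀] {E : Set V} {E₀ : Set V₀}
    [Module (ZMod 2) V] [Module (ZMod 2) V₀]
    (R : V → V₀ → Prop) (tot : ∀ v, ∃ u, R v u) (ad : ∀ v u v' u', R v u → R v' u' → R (v + v') (u + u'))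
    (hE : ∀ v u, R v u → (v ∈ E ↔ u ∈ E₀)) (h : FreeI E₀) : FreeI E := by
  intro a b c
  obtain ⟨a', ra⟩ := tot a
  obtain ⟨b', rb⟩ := tot b
  obtain ⟨c', rc⟩ := tot c
  have rbc := ad _ _ _ _ rb rc
  rw [hE _ _ ra, hE _ _ rb, hE _ _ rc, hE _ _ (ad _ _ _ _ ra rb), hE _ _ (ad _ _ _ _ ra rc),
    hE _ _ rbc, hE _ _ (ad _ _ _ _ ra rbc)]
  exact h a' b' c'

theorem transferF {V V₀ : Type*} [AddCommGroup V] [AddCommGroup V₀] {E : Set V} {E₀ : Set V₀}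
    [Module (ZMod 2) V] [Module (ZMod 2) V₀]
    (R : V → V₀ → Prop) (tot : ∀ v, ∃ u, R v u) (ad : ∀ v u v' u', R v u → R v' u' → R (v + v') (u + u'))
    (hE : ∀ v u, R v u → (v ∈ E ↔ u ∈ E₀)) (h : FreeF E₀) : FreeF E := by
  intro a b c
  obtain ⟨a', ra⟩ := tot a
  obtain ⟨b', rb⟩ := tot b
  obtain ⟨c', rc⟩ := tot c
  have rbc := ad _ _ _ _ rb rc
  rw [hE _ _ ra, hE _ _ rb, hE _ _ rc, hE _ _ (ad _ _ _ _ ra rb), hE _ _ (ad _ _ _ _ ra rc),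
    hE _ _ rbc, hE _ _ (ad _ _ _ _ ra rbc)]
  exact h a' b' c'

theorem hyper_cover {n : ℕ} {H : Submodule (ZMod 2) (Fin n → ZMod 2)}
    (hH : Module.finrank (ZMod 2) H + 1 = n) {u : Fin n → ZMod 2} (hu : u ∉ H) (v : Fin n → ZMod 2) :
    v ∈ H ∨ v + u ∈ H := by
  have h1 : H ⊔ Submodule.span (ZMod 2) {u} = ⊤ := by
    apply Submodule.eq_top_of_finrank_eq
    rw [Submodule.finrank_sup_span_singleton hu, Module.finrank_fin_fun, hH]
  have h2 : v ∈ H ⊔ Submodule.span (ZMod 2) {u} := by rw [h1]; trivial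
  exact mem_sup_sp.1 h2

theorem doubling_rel {M M₀ : BinMatroid} (h : M.IsDoublingOf M₀) :
    ∃ R : (Fin M.dim → ZMod 2) → (Fin M₀.dim → ZMod 2) → Prop, (∀ v, ∃ u, R v u) ∧
      (∀ v u v' u', R v u → R v' u' → R (v + v') (u + u')) ∧
      (∀ v u, R v u → (v ∈ M.E ↔ u ∈ M₀.E)) := by
  obtain ⟨hd, φ, hφ, w, -, hw, -, hE⟩ := h
  have hw' : w ∉ LinearMap.range φ := hw
  refine ⟨fun v u => v = φ u ∨ v = w + φ u, ?_, ?_, ?_⟩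
  · intro v
    have := hyper_cover (H := LinearMap.range φ)
      (by rw [LinearMap.finrank_range_of_inj hφ, Module.finrank_fin_fun, hd]) hw' v
    rcases this with ⟨u, hu⟩ | ⟨u, hu⟩
    · exact ⟨u, Or.inl hu.symm⟩
    · refine ⟨u, Or.inr ?_⟩
      rw [hu, add_comm v w, z2_left]
  · rintro v u v' u' (rfl | rfl) (rfl | rfl) <;> rw [map_add] <;>
      simp only [add_comm, add_left_comm, add_assoc, z2_self, z2_left, add_zero, zero_add] <;> tauto
  · have ne : ∀ u u', φ u ≠ w + φ u' := by
      intro u u' e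
      apply hw
      refine ⟨u + u', ?_⟩
      rw [map_add, e, add_assoc, z2_self, add_zero]
    rintro v u (rfl | rfl) <;> rw [hE]
    · constructor
      · rintro (⟨u', hu', e⟩ | ⟨_, ⟨u', hu', rfl⟩, e⟩)
        · rwa [← hφ e]
        · exact absurd e.symm (ne _ _)
      · intro hu; exact Or.inl ⟨u, hu, rfl⟩
    · constructor
      · rintro (⟨u', hu', e⟩ | ⟨_, ⟨u', hu', rfl⟩, e⟩)
        · exact absurd e (ne _ _)
        · rwa [← hφ (add_left_cancel e)]
      · intro hu; exact Or.inr ⟨_, ⟨u, hu, rfl⟩, rfl⟩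

theorem iso_rel {M M₀ : BinMatroid} (h : M.Iso M₀) :
    ∃ R : (Fin M.dim → ZMod 2) → (Fin M₀.dim → ZMod 2) → Prop, (∀ v, ∃ u, R v u) ∧
      (∀ v u v' u', R v u → R v' u' → R (v + v') (u + u')) ∧
      (∀ v u, R v u → (v ∈ M.E ↔ u ∈ M₀.E)) := by
  obtain ⟨φ, hφ, hE⟩ := h
  refine ⟨fun v u => v = φ u, ?_, ?_, ?_⟩
  · intro v
    obtain ⟨u, hu⟩ := hφ.2 v
    exact ⟨u, hu.symm⟩
  · rintro v u v' u' rfl rfl; rw [map_add]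
  · rintro v u rfl
    constructor
    · intro hv
      have : φ u ∈ φ '' M₀.E := by
        rw [hE]
        refine ⟨hv, ⟨u, rfl⟩, fun h0 => M.zero_not_mem ?_⟩
        rw [Set.mem_singleton_iff] at h0
        rwa [h0] at hv
      obtain ⟨u', hu', e⟩ := this
      rwa [← hφ.1 e]
    · intro hu
      have : φ u ∈ φ '' M₀.E := ⟨u, hu, rfl⟩
      rw [hE] at this
      exact this.1

theorem AGo_free {M : BinMatroid} (h : M.IsAGo) : FreeI M.E ∧ FreeF M.E := by
  obtain ⟨H, hH, x, ⟨xH, x0⟩, hE⟩ := h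
  have xH' : x ∈ H := xH
  have mem : ∀ v, v ∈ M.E ↔ (v ∉ H ∨ v = x) := by
    intro v
    rw [hE]
    constructor
    · rintro (⟨_, h⟩ | h)
      · exact Or.inl h
      · exact Or.inr h
    · rintro (h | h)
      · exact Or.inl ⟨fun h0 => h (h0 ▸ zero_mem H), h⟩
      · exact Or.inr h
  have E0 := M.zero_not_mem
  have hyp : ∀ u v, u ∉ H → v ∉ H → u + v ∈ H := by
    intro u v hu hv
    exact (hyper_cover hH hv u).resolve_left hu
  have inH : ∀ u, u ∈ H → u ∈ M.E → u = x := by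
    intro u hu hE
    rcases (mem u).1 hE with h | h
    · exact absurd hu h
    · exact h
  have nE : ∀ u, u ∉ M.E → u ∈ H := by
    intro u hu
    by_contra h
    exact hu ((mem u).2 (Or.inl h))
  constructor
  · intro a b c ha hb hc hab hac hbc habc
    have hbc' := nE _ hbc
    have hab' := nE _ hab
    have habc' := nE _ habc
    have aH : a ∈ H := by
      have := add_mem habc' hbc'
      rwa [add_assoc, z2_self, add_zero] at this
    have bH : b ∈ H := (mem_add_left aH).1 hab'
    have e : a = b := (inH _ aH ha).trans (inH _ bH hb).symm
    subst e
    rw [z2_left] at habc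
    exact habc hc
  · intro a b c ha hb hc hab hac hbc habc
    by_cases aH : a ∈ H
    · have e1 := inH _ aH ha
      by_cases bH : b ∈ H
      · have e2 := inH _ bH hb
        rw [e1, e2, z2_self] at hab; exact E0 hab
      · by_cases cH : c ∈ H
        · have e2 := inH _ cH hc
          rw [e1, e2, z2_self] at hac; exact E0 hac
        · have e2 := inH _ (hyp _ _ bH cH) hbc
          rw [e1, e2, z2_self] at habc; exact E0 habc
    · by_cases bH : b ∈ H
      · have e1 := inH _ bH hb
        by_cases cH : c ∈ H
        · have e2 := inH _ cH hc
          rw [e1, e2, z2_self] at hbc; exact E0 hbc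
        · have e2 := inH _ (hyp _ _ aH cH) hac
          rw [add_left_comm, e1, e2, z2_self] at habc; exact E0 habc
      · have e1 := inH _ (hyp _ _ aH bH) hab
        by_cases cH : c ∈ H
        · have e2 := inH _ cH hc
          rw [← add_assoc, e1, e2, z2_self] at habc; exact E0 habc
        · have e2 := inH _ (hyp _ _ aH cH) hac
          rw [← e2] at e1
          rw [add_left_cancel e1, z2_self] at hbc; exact E0 hbc

theorem arises_free {M M₀ : BinMatroid} (h₀ : M₀.IsAGo) (h : M.ArisesByDoublings M₀) :
    FreeI M.E ∧ FreeF M.E := by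
  obtain ⟨M', hM', hiso⟩ := h
  have : FreeI M'.E ∧ FreeF M'.E := by
    clear hiso
    induction hM' with
    | refl => exact AGo_free h₀
    | tail _ hd ih =>
      obtain ⟨R, r1, r2, r3⟩ := doubling_rel hd
      exact ⟨transferI R r1 r2 r3 ih.1, transferF R r1 r2 r3 ih.2⟩
  obtain ⟨R, r1, r2, r3⟩ := iso_rel hiso
  exact ⟨transferI R r1 r2 r3 this.1, transferF R r1 r2 r3 this.2⟩

end Conv
section Forward

theorem exists_top {n : ℕ} {E : Set (Fin n → ZMod 2)} (hspan : Submodule.span (ZMod 2) E = ⊤)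
    (hI : FreeI E) (hF : FreeF E) : ∀ (k : ℕ) (W H U : Submodule (ZMod 2) (Fin n → ZMod 2))
    (x b y : Fin n → ZMod 2), n - Module.finrank (ZMod 2) W ≤ k → StrAt E W H U x b y →
    ∃ H U x b y, StrAt E ⊤ H U x b y := by
  intro k
  induction k with
  | zero =>
    intro W H U x b y hk S
    have hW : W = ⊤ := by
      apply Submodule.eq_top_of_finrank_eq
      have := Submodule.finrank_le W
      rw [Module.finrank_fin_fun] at *
      omega
    subst hW
    exact ⟨H, U, x, b, y, S⟩
  | succ k ih =>
    intro W H U x b y hk S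
    by_cases hW : W = ⊤
    · subst hW
      exact ⟨H, U, x, b, y, S⟩
    · have : ¬ E ⊆ W := by
        intro h
        apply hW
        rw [eq_top_iff, ← hspan]
        exact Submodule.span_le.2 h
      obtain ⟨v, hv, hvW⟩ := Set.not_subset.1 this
      have hvW' : v ∉ W := hvW
      obtain ⟨H', U', S'⟩ := S.extend hI hF hv hvW'
      refine ih _ _ _ _ _ _ ?_ S'
      rw [Submodule.finrank_sup_span_singleton hvW']
      omega

theorem AGo_of_bot {n : ℕ} {E : Set (Fin n → ZMod 2)} (E0 : 0 ∉ E)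
    {H : Submodule (ZMod 2) (Fin n → ZMod 2)} {x b y : Fin n → ZMod 2}
    (S : StrAt E ⊤ H ⊥ x b y) : 3 ≤ n ∧ (BinMatroid.mk n E E0).IsAGo := by
  have hx0 : x ≠ 0 := fun h => S.xU (by rw [h]; exact zero_mem _)
  have hb0 : b ≠ 0 := fun h => S.bU (by rw [h]; exact zero_mem _)
  have hbx : b + x ≠ 0 := fun h => S.bxU (by rw [h]; exact zero_mem _)
  have hH : Module.finrank (ZMod 2) H + 1 = n := by
    rw [← Submodule.finrank_sup_span_singleton S.yH]
    have : H ⊔ Submodule.span (ZMod 2) {y} = ⊤ := by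
      rw [eq_top_iff]
      intro z _
      rw [mem_sup_sp]
      by_cases hz : z ∈ H
      · exact Or.inl hz
      · exact Or.inr (S.hyp z trivial hz)
    rw [this, finrank_top, Module.finrank_fin_fun]
  constructor
  · have h1 : x ∉ (⊥ : Submodule (ZMod 2) (Fin n → ZMod 2)) := S.xU
    have h2 : b ∉ (⊥ : Submodule (ZMod 2) (Fin n → ZMod 2)) ⊔ Submodule.span (ZMod 2) {x} := by
      rw [mem_sup_sp, Submodule.mem_bot, Submodule.mem_bot]
      tauto
    have h3 : (⊥ : Submodule (ZMod 2) (Fin n → ZMod 2)) ⊔ Submodule.span (ZMod 2) {x} ⊔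
        Submodule.span (ZMod 2) {b} ≤ H := by
      refine sup_le (sup_le bot_le ?_) ?_
      · rw [Submodule.span_singleton_le_iff_mem]; exact S.xH
      · rw [Submodule.span_singleton_le_iff_mem]; exact S.bH
    have h4 := Submodule.finrank_mono h3
    rw [Submodule.finrank_sup_span_singleton h2, Submodule.finrank_sup_span_singleton h1] at h4
    omega
  · refine ⟨H, hH, x, ⟨S.xH, hx0⟩, ?_⟩
    ext v
    have h := S.iff v trivial
    rw [Submodule.mem_bot, add_eq_zero_z2] at h
    refine h.trans ?_
    constructor
    · rintro (h | h)
      · exact Or.inl ⟨fun h0 => h (h0 ▸ zero_mem H), h⟩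
      · exact Or.inr h
    · rintro (⟨_, h⟩ | h)
      · exact Or.inl h
      · exact Or.inr h

theorem StrAt.pull {V V₀ : Type*} [AddCommGroup V] [Module (ZMod 2) V] [AddCommGroup V₀]
    [Module (ZMod 2) V₀] {E : Set V} {H U : Submodule (ZMod 2) V} {x b y : V}
    (S : StrAt E ⊤ H U x b y) (φ : V₀ →ₗ[ZMod 2] V)
    (hφ : ∀ v, ∃ u s, s ∈ U ∧ v = s + φ u) :
    ∃ x₀ b₀ y₀, StrAt (φ ⁻¹' E) ⊤ (H.comap φ) (U.comap φ) x₀ b₀ y₀ := by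
  obtain ⟨UH, -, xH, xU, bH, bU, bxU, -, yH, hyp, iff⟩ := S
  obtain ⟨x₀, s, hs, rfl⟩ := hφ x
  obtain ⟨b₀, s', hs', rfl⟩ := hφ b
  obtain ⟨y₀, s'', hs'', rfl⟩ := hφ y
  rw [mem_add_left (UH hs)] at xH
  rw [mem_add_left (UH hs')] at bH
  rw [mem_add_left (UH hs'')] at yH
  rw [mem_add_left hs] at xU
  rw [mem_add_left hs'] at bU
  rw [add_assoc, mem_add_left hs', add_left_comm, mem_add_left hs, ← map_add] at bxU
  refine ⟨x₀, b₀, y₀, Submodule.comap_mono UH, le_top, xH, xU, bH, bU, bxU, trivial, yH, ?_, ?_⟩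
  · intro z _ hz
    have := hyp (φ z) trivial hz
    rw [add_left_comm, mem_add_left (UH hs''), ← map_add] at this
    exact this
  · intro z _
    have := iff (φ z) trivial
    rw [add_left_comm, mem_add_left hs, ← map_add] at this
    exact this

theorem exists_hyper {m : ℕ} {w : Fin (m + 1) → ZMod 2} (w0 : w ≠ 0) :
    ∃ φ : (Fin m → ZMod 2) →ₗ[ZMod 2] (Fin (m + 1) → ZMod 2), Function.Injective φ ∧
      w ∉ Set.range φ ∧ ∀ v, ∃ u, v = φ u ∨ v = w + φ u := by
  obtain ⟨i, hi⟩ := Function.ne_iff.1 w0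
  have z : ∀ c : ZMod 2, c ≠ 0 → c = 1 := by decide
  have z' : ∀ c : ZMod 2, c ≠ 0 → c + 1 = 0 := by decide
  have hi1 : w i = 1 := z _ hi
  obtain ⟨K, hK⟩ : ∃ K : Submodule (ZMod 2) (Fin (m + 1) → ZMod 2), ∀ v, v ∈ K ↔ v i = 0 :=
    ⟨LinearMap.ker (LinearMap.proj i : (Fin (m + 1) → ZMod 2) →ₗ[ZMod 2] ZMod 2), fun v => by
      simp [LinearMap.mem_ker]⟩
  have hwK : w ∉ K := fun h => hi ((hK w).1 h)
  have cov : ∀ v, v ∈ K ∨ v + w ∈ K := by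
    intro v
    rw [hK, hK]
    by_cases h : v i = 0
    · exact Or.inl h
    · exact Or.inr (by rw [Pi.add_apply, hi1]; exact z' _ h)
  have hfin : Module.finrank (ZMod 2) K = m := by
    have h1 := Submodule.finrank_sup_span_singleton hwK
    have : K ⊔ Submodule.span (ZMod 2) {w} = ⊤ := by
      rw [eq_top_iff]
      intro v _
      rw [mem_sup_sp]
      exact cov v
    rw [this, finrank_top, Module.finrank_fin_fun] at h1
    omega
  have e : (Fin m → ZMod 2) ≃ₗ[ZMod 2] K := LinearEquiv.ofFinrankEq _ _ (by
    rw [hfin, Module.finrank_fin_fun])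
  refine ⟨K.subtype ∘ₗ e.toLinearMap, ?_, ?_, ?_⟩
  · intro u v h
    exact e.injective (Subtype.ext h)
  · rintro ⟨u, rfl⟩
    exact hwK (e u).2
  · intro v
    rcases cov v with h | h
    · refine ⟨e.symm ⟨v, h⟩, Or.inl ?_⟩
      simp
    · refine ⟨e.symm ⟨v + w, h⟩, Or.inr ?_⟩
      simp [add_comm v w, z2_left]

theorem build : ∀ (n : ℕ) (E : Set (Fin n → ZMod 2)) (E0 : 0 ∉ E)
    (H U : Submodule (ZMod 2) (Fin n → ZMod 2)) (x b y : Fin n → ZMod 2), StrAt E ⊤ H U x b y →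
    ∃ M₀ : BinMatroid, 3 ≤ M₀.dim ∧ M₀.IsAGo ∧
      Relation.ReflTransGen (fun A B => BinMatroid.IsDoublingOf B A) M₀ ⟨n, E, E0⟩ := by
  intro n
  induction n with
  | zero =>
    intro E E0 H U x b y S
    exact absurd (by rw [Subsingleton.elim x 0]; exact zero_mem U) S.xU
  | succ m ih =>
    intro E E0 H U x b y S
    by_cases hU : U = ⊥
    · subst hU
      exact ⟨⟨_, E, E0⟩, (AGo_of_bot E0 S).1, (AGo_of_bot E0 S).2, Relation.ReflTransGen.refl⟩
    · obtain ⟨w, hw, w0⟩ := Submodule.exists_mem_ne_zero_of_ne_bot hU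
      obtain ⟨φ, hφ, hwφ, cov⟩ := exists_hyper w0
      obtain ⟨x₀, b₀, y₀, S₀⟩ := S.pull φ (by
        intro v
        obtain ⟨u, h | h⟩ := cov v
        · exact ⟨u, 0, zero_mem _, by rw [zero_add]; exact h⟩
        · exact ⟨u, w, hw, h⟩)
      have E0' : (0 : Fin m → ZMod 2) ∉ φ ⁻¹' E := by
        rw [Set.mem_preimage, map_zero]; exact E0
      obtain ⟨M₀, h1, h2, h3⟩ := ih _ E0' _ _ _ _ _ S₀
      refine ⟨M₀, h1, h2, h3.tail ?_⟩
      have inv : ∀ v, w + v ∈ E ↔ v ∈ E := by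
        intro v
        rw [S.iff _ trivial, S.iff _ trivial, mem_add_left (S.UH hw), add_assoc, mem_add_left hw]
      refine ⟨rfl, φ, hφ, w, w0, hwφ, ?_, ?_⟩
      · intro h
        have := (inv 0).1 (by rw [add_zero]; exact h)
        exact E0 this
      · ext v
        constructor
        · intro hv
          obtain ⟨u, h | h⟩ := cov v
          · subst h
            exact Or.inl ⟨u, hv, rfl⟩
          · subst h
            exact Or.inr ⟨_, ⟨u, (inv _).1 hv, rfl⟩, rfl⟩
        · rintro (⟨u, hu, rfl⟩ | ⟨_, ⟨u, hu, rfl⟩, rfl⟩)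
          · exact hu
          · exact (inv _).2 hu

theorem iso_refl (M : BinMatroid) : M.Iso M := by
  refine ⟨LinearMap.id, Function.bijective_id, ?_⟩
  ext v
  constructor
  · rintro ⟨u, hu, rfl⟩
    refine ⟨hu, ⟨u, rfl⟩, fun h => M.zero_not_mem ?_⟩
    have h' : u = 0 := h
    rwa [h'] at hu
  · rintro ⟨h, _⟩
    exact ⟨v, h, rfl⟩

end Forward

/-- A full-rank simple binary matroid `M` contains neither `I₃` nor `F₇`
as an induced restriction if and only if either `M ∈ ℰ₃`, or there is some `t ≥ 3` such
that `M` arises from `AG°(t−1, 2)` by a sequence of doublings. -/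
theorem stmt3 (M : BinMatroid) (hfull : M.FullRank) :
    (¬ M.HasIR I3 ∧ ¬ M.HasIR F7) ↔
      (M.MemE 3 ∨ ∃ t : ℕ, 3 ≤ t ∧ ∃ M₀ : BinMatroid, M₀.dim = t ∧
        M₀.IsAGo ∧ M.ArisesByDoublings M₀) := by
  classical
  constructor
  · rintro ⟨h1, h2⟩
    have hI := (freeI_iff M).1 h1
    have hF := (freeF_iff M).1 h2
    have E0 := M.zero_not_mem
    by_cases hT : ∀ a b c, a ∈ M.E → b ∈ M.E → c ∈ M.E →
        T3 (fun v => if v ∈ M.E then (1 : ZMod 2) else 0) a b c = 0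
    · left
      have hf : ∀ v, (if v ∈ M.E then (1 : ZMod 2) else 0) = 1 ↔ v ∈ M.E := by
        intro v
        by_cases hv : v ∈ M.E <;> simp [hv]
      intro W hW
      refine even_of_T3 E0 hf (T3_all (if_neg E0) ?_ ?_) W hW
      · have : {v | (if v ∈ M.E then (1 : ZMod 2) else 0) = 1} = M.E := Set.ext hf
        rw [this]
        exact hfull
      · intro a b c ha hb hc
        exact hT a b c ((hf a).1 ha) ((hf b).1 hb) ((hf c).1 hc)
    · right
      push Not at hT
      obtain ⟨a, b, c, ha, hb, hc, h⟩ := hT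
      obtain ⟨W, H, U, x, b', y, S⟩ := StrAt.of_T3 E0 hI hF ha hb hc h
      obtain ⟨H, U, x, b', y, S⟩ := exists_top hfull hI hF _ W H U x b' y le_rfl S
      obtain ⟨M₀, g1, g2, g3⟩ := build _ M.E E0 H U x b' y S
      exact ⟨_, g1, M₀, rfl, g2, M, g3, iso_refl M⟩
  · rintro (h | ⟨t, _, M₀, _, h₀, h⟩)
    · exact ⟨memE_not h rfl (by rw [ncard_I3]; decide), memE_not h rfl (by rw [ncard_F7]; decide)⟩
    · have := arises_free h₀ h
      exact ⟨(freeI_iff M).2 this.1, (freeF_iff M).2 this.2⟩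
end

section
/- Let M = (E, G) be a full-rank n-dimensional matroid with no induced I₃- or F₇-restriction. Let w ∈ G − E, let H be a hyperplane of G not containing w, and for each i ∈ {0, 1, 2} let B_i = {x ∈ H : |{x, x+w} ∩ E| = i}. If B₁ and B₂ are both nonempty, then for some i ∈ {1, 2} the matroid (B_i, H) is isomorphic to AG(n−2, 2), i.e., B_i = H − H₀ for some hyperplane H₀ of H. -/
/-- The set `B_i = {x ∈ H : |{x, x+w} ∩ E| = i}`, for `H` a flat (so `x` ranges over the
nonzero vectors of `H`). -/
def Bset {n : ℕ} (E : Set (Fin n → ZMod 2)) (H : Submodule (ZMod 2) (Fin n → ZMod 2))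
    (w : Fin n → ZMod 2) (i : ℕ) : Set (Fin n → ZMod 2) :=
  {x | x ∈ (H : Set (Fin n → ZMod 2)) \ {0} ∧
    (({x, x + w} : Set (Fin n → ZMod 2)) ∩ E).ncard = i}

namespace Stmt18Aux

variable {V : Type*} [AddCommGroup V]

/-- Standing assumptions: elementary abelian 2-group, claw-free and Fano-free set `E`, `w ∉ E`. -/
structure Ctx (E : V → Prop) (w : V) : Prop where
  hs : ∀ x : V, x + x = 0
  h0 : ¬ E 0
  hw : ¬ E w
  hw0 : w ≠ 0
  hI : ∀ a b c, E a → E b → E c → a ≠ b → a ≠ c → b ≠ c →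
    E (a + b) ∨ E (a + c) ∨ E (b + c) ∨ E (a + b + c)
  hF : ∀ a b c, ¬ (E a ∧ E b ∧ E c ∧ E (a + b) ∧ E (a + c) ∧ E (b + c) ∧ E (a + b + c))
  hsp : ∀ v, v = 0 ∨ E v ∨ ∃ a b, E a ∧ E b ∧ v = a + b

def T0 (E : V → Prop) (w x : V) : Prop := ¬ E x ∧ ¬ E (x + w)
def T1 (E : V → Prop) (w x : V) : Prop := (E x ∧ ¬ E (x + w)) ∨ (¬ E x ∧ E (x + w))
def T2 (E : V → Prop) (w x : V) : Prop := E x ∧ E (x + w)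

variable {E : V → Prop} {w : V}

theorem Ctx.hs' (h : Ctx E w) (x y : V) : x + (x + y) = y := by
  rw [← add_assoc, h.hs, zero_add]

theorem Ctx.eqz (h : Ctx E w) {x y : V} (hxy : x + y = 0) : x = y := by
  have := h.hs' x y
  rw [hxy, add_zero] at this
  exact this

theorem Ctx.T0w (h : Ctx E w) (x : V) : T0 E w (x + w) ↔ T0 E w x := by
  unfold T0
  rw [add_assoc, h.hs, add_zero]
  tauto
theorem Ctx.T1w (h : Ctx E w) (x : V) : T1 E w (x + w) ↔ T1 E w x := by
  unfold T1
  rw [add_assoc, h.hs, add_zero]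
  tauto
theorem Ctx.T2w (h : Ctx E w) (x : V) : T2 E w (x + w) ↔ T2 E w x := by
  unfold T2
  rw [add_assoc, h.hs, add_zero]
  tauto

/-- no rainbow triangle, with a chosen representative -/
theorem Ctx.nr' (h : Ctx E w) {x y : V} (hx : E x) (hx' : ¬ E (x + w)) (hy : T2 E w y) :
    ¬ T0 E w (x + y) := by
  rintro ⟨h1, h2⟩
  have hh := h.hI x y (y + w) hx hy.1 hy.2
    (by rintro rfl; exact hx' hy.2)
    (by rintro rfl; apply hx'; rw [add_assoc, h.hs, add_zero]; exact hy.1)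
    (by intro e; exact h.hw0 (by simpa using e))
  have e1 : y + (y + w) = w := h.hs' _ _
  have e2 : x + y + (y + w) = x + w := by rw [add_assoc, e1]
  have e3 : x + (y + w) = x + y + w := by rw [add_assoc]
  rw [e1, e2, e3] at hh
  have := h.hw
  tauto

theorem Ctx.nr (h : Ctx E w) {x y : V} (hx : T1 E w x) (hy : T2 E w y) :
    ¬ T0 E w (x + y) := by
  rcases hx with hx | hx
  · exact h.nr' hx.1 hx.2 hy
  · have := h.nr' (x := x + w) (y := y) hx.2 (by rw [add_assoc, h.hs, add_zero]; exact hx.1) hy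
    rw [add_right_comm, h.T0w] at this
    exact this

theorem Ctx.nr01 (h : Ctx E w) {x y : V} (hx : T0 E w x) (hy : T1 E w y) :
    ¬ T2 E w (x + y) := by
  intro hc
  have := h.nr hy hc
  rw [add_left_comm, h.hs, add_zero] at this
  exact this hx

theorem Ctx.nr02 (h : Ctx E w) {x y : V} (hx : T0 E w x) (hy : T2 E w y) :
    ¬ T1 E w (x + y) := by
  intro hc
  have := h.nr hc hy
  rw [add_assoc, h.hs, add_zero] at this
  exact this hx

/-- representatives of an all-1 triangle form a triangle -/
theorem Ctx.lin (h : Ctx E w) (x y : V) (hx : E x) (hy : E y) (hz : E (x + y + w)) :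
    E (x + w) ∨ E (y + w) ∨ E (x + y) := by
  have hh := h.hI x y (x + y + w) hx hy hz
    (by rintro rfl; rw [h.hs, zero_add] at hz; exact h.hw hz)
    (by intro e
        have e' : y + w = 0 := by rw [add_assoc] at e; simpa using e
        rw [h.eqz e'] at hy; exact h.hw hy)
    (by intro e
        have e' : x + w = 0 := by rw [add_comm x y, add_assoc] at e; simpa using e
        rw [h.eqz e'] at hx; exact h.hw hx)
  have e1 : x + (x + y + w) = y + w := by rw [add_assoc, h.hs']
  have e2 : y + (x + y + w) = x + w := by rw [add_comm x y, add_assoc, h.hs']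
  have e3 : x + y + (x + y + w) = w := h.hs' _ _
  rw [e1, e2, e3] at hh
  have := h.hw
  tauto

theorem col (E : V → Prop) (w x : V) : T0 E w x ∨ T1 E w x ∨ T2 E w x := by
  unfold T0 T1 T2; tauto
theorem n12 {x : V} (a : T1 E w x) (b : T2 E w x) : False := by
  unfold T1 at a; unfold T2 at b; tauto
theorem n01 {x : V} (a : T0 E w x) (b : T1 E w x) : False := by
  unfold T1 at b; unfold T0 at a; tauto
theorem n02 {x : V} (a : T0 E w x) (b : T2 E w x) : False := by
  unfold T2 at b; unfold T0 at a; tauto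

/-- all seven points of a Fano plane are nonzero colour: one of the colours is affine.
Pure propositional core. -/
theorem Kprop {a a' b b' c c' d d' e e' f f' g g' : Prop}
    (A1 : a ∨ a') (A2 : b ∨ b') (A3 : c ∨ c') (A4 : d ∨ d') (A5 : e ∨ e') (A6 : f ∨ f')
    (A7 : g ∨ g')
    (F1 : ¬ (a ∧ b ∧ c ∧ d ∧ e ∧ f ∧ g))
    (F2 : ¬ (a' ∧ b ∧ c ∧ d' ∧ e' ∧ f ∧ g'))
    (F3 : ¬ (a ∧ b' ∧ c ∧ d' ∧ e ∧ f' ∧ g'))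
    (F4 : ¬ (a ∧ b ∧ c' ∧ d ∧ e' ∧ f' ∧ g'))
    (F5 : ¬ (a' ∧ b' ∧ c ∧ d ∧ e' ∧ f' ∧ g))
    (F6 : ¬ (a' ∧ b ∧ c' ∧ d' ∧ e ∧ f' ∧ g))
    (F7 : ¬ (a ∧ b' ∧ c' ∧ d' ∧ e' ∧ f ∧ g))
    (F8 : ¬ (a' ∧ b' ∧ c' ∧ d ∧ e ∧ f ∧ g'))
    (L1 : ((a ∧ b ∧ d') ∨ (a ∧ b' ∧ d) ∨ (a' ∧ b ∧ d) ∨ (a' ∧ b' ∧ d')) →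
      (a ∧ a') ∨ (b ∧ b') ∨ (d ∧ d'))
    (L2 : ((a ∧ c ∧ e') ∨ (a ∧ c' ∧ e) ∨ (a' ∧ c ∧ e) ∨ (a' ∧ c' ∧ e')) →
      (a ∧ a') ∨ (c ∧ c') ∨ (e ∧ e'))
    (L3 : ((b ∧ c ∧ f') ∨ (b ∧ c' ∧ f) ∨ (b' ∧ c ∧ f) ∨ (b' ∧ c' ∧ f')) →
      (b ∧ b') ∨ (c ∧ c') ∨ (f ∧ f'))
    (L4 : ((a ∧ f ∧ g') ∨ (a ∧ f' ∧ g) ∨ (a' ∧ f ∧ g) ∨ (a' ∧ f' ∧ g')) →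
      (a ∧ a') ∨ (f ∧ f') ∨ (g ∧ g'))
    (L5 : ((b ∧ e ∧ g') ∨ (b ∧ e' ∧ g) ∨ (b' ∧ e ∧ g) ∨ (b' ∧ e' ∧ g')) →
      (b ∧ b') ∨ (e ∧ e') ∨ (g ∧ g'))
    (L6 : ((c ∧ d ∧ g') ∨ (c ∧ d' ∧ g) ∨ (c' ∧ d ∧ g) ∨ (c' ∧ d' ∧ g')) →
      (c ∧ c') ∨ (d ∧ d') ∨ (g ∧ g'))
    (L7 : ((d ∧ e ∧ f') ∨ (d ∧ e' ∧ f) ∨ (d' ∧ e ∧ f) ∨ (d' ∧ e' ∧ f')) →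
      (d ∧ d') ∨ (e ∧ e') ∨ (f ∧ f')) (ha : ¬ (a ∧ a')) (hb : b ∧ b') :
    (¬ (d ∧ d') → (((e ∧ e') ↔ ¬ (c ∧ c')) ∧ ((f ∧ f') ↔ (c ∧ c')))) ∧
    ((d ∧ d') → (((f ∧ f') ↔ ¬ (c ∧ c')) ∧ ((e ∧ e') ↔ (c ∧ c')))) := by
  obtain ⟨hb1, hb2⟩ := hb
  by_cases ha' : a <;> by_cases hc : c <;> by_cases hc' : c' <;> by_cases hd : d <;>
    by_cases hd' : d' <;> simp_all only [true_and, and_true, not_true, not_false_iff, true_or, or_true, false_or, or_false, false_and, and_false, true_implies, false_implies, not_and, imp_false, iff_true, iff_false, true_iff, false_iff] <;> grind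

theorem Ctx.linp (h : Ctx E w) (x y z : V) (hz : z = x + y) :
    ((E x ∧ E y ∧ E (z + w)) ∨ (E x ∧ E (y + w) ∧ E z) ∨ (E (x + w) ∧ E y ∧ E z) ∨
      (E (x + w) ∧ E (y + w) ∧ E (z + w))) →
      (E x ∧ E (x + w)) ∨ (E y ∧ E (y + w)) ∨ (E z ∧ E (z + w)) := by
  subst hz
  have ww : ∀ v, v + w + w = v := fun v => by rw [add_assoc, h.hs, add_zero]
  have q1 : x + w + y = x + y + w := add_right_comm _ _ _
  have q2 : x + (y + w) = x + y + w := by rw [add_assoc]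
  have q3 : x + w + (y + w) = x + y := by rw [q2.symm.trans q2 |> fun _ => add_add_add_comm x w y w, h.hs, add_zero]
  have l1 := h.lin x y
  have l2 := h.lin (x + w) y
  have l3 := h.lin x (y + w)
  have l4 := h.lin (x + w) (y + w)
  simp only [ww, q1, q2, q3] at l1 l2 l3 l4
  clear q1 q2 q3 ww
  grind

/-- Propagation along `L = ⟨p, q⟩` when the whole plane avoids colour 0. -/
theorem Ctx.K (h : Ctx E w) (p q x : V) (hp : T1 E w p) (hq : T2 E w q)
    (A4 : ¬ T0 E w (p + q)) (A3 : ¬ T0 E w x) (A5 : ¬ T0 E w (x + p)) (A6 : ¬ T0 E w (x + q))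
    (A7 : ¬ T0 E w (x + p + q)) :
    (¬ T2 E w (p + q) → ((T2 E w (x + p) ↔ ¬ T2 E w x) ∧ (T2 E w (x + q) ↔ T2 E w x))) ∧
    (T2 E w (p + q) → ((T2 E w (x + q) ↔ ¬ T2 E w x) ∧ (T2 E w (x + p) ↔ T2 E w x))) := by
  have cv : ∀ v, ¬ T0 E w v → E v ∨ E (v + w) := by intro v; unfold T0; tauto
  have hh := h.hs
  have hh' := h.hs'
  have f1 := h.hF p q x
  have f2 := h.hF (p + w) q x
  have f3 := h.hF p (q + w) x
  have f4 := h.hF p q (x + w)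
  have f5 := h.hF (p + w) (q + w) x
  have f6 := h.hF (p + w) q (x + w)
  have f7 := h.hF p (q + w) (x + w)
  have f8 := h.hF (p + w) (q + w) (x + w)
  have l1 := h.linp p q (p + q) rfl
  have l2 := h.linp p x (x + p) (add_comm _ _)
  have l3 := h.linp q x (x + q) (add_comm _ _)
  have l4 := h.linp p (x + q) (x + p + q) (by abel)
  have l5 := h.linp q (x + p) (x + p + q) (by abel)
  have l6 := h.linp x (p + q) (x + p + q) (by abel)
  have l7 := h.linp (p + q) (x + p) (x + q) (by
    rw [add_comm x p, add_comm p q, add_assoc, hh', add_comm])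
  have ha : ¬ (E p ∧ E (p + w)) := fun hc => n12 hp hc
  have hp' : E p ∨ E (p + w) := cv _ (fun hc => n01 hc hp)
  have hq' : E q ∨ E (q + w) := cv _ (fun hc => n02 hc hq)
  have A3 := cv _ A3
  have A4 := cv _ A4
  have A5 := cv _ A5
  have A6 := cv _ A6
  have A7 := cv _ A7
  unfold T2 at hq ⊢
  clear hp cv
  simp only [add_comm, add_left_comm, add_assoc, hh, hh', add_zero, zero_add] at *
  exact Kprop hp' hq' A3 A4 A5 A6 A7 f1 f2 f3 f4 f5 f6 f7 f8 l1 l2 l3 l4 l5 l6 l7 ha hq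

theorem Ctx.B (h : Ctx E w) (p q x : V) (hp : T1 E w p) (hq : T2 E w q) :
    (T0 E w x ∧ T0 E w (x + p) ∧ T0 E w (x + q) ∧ T0 E w (x + p + q)) ∨
    ((T1 E w (p + q) → ((T1 E w (x + p) ↔ ¬ T1 E w x) ∧ (T1 E w (x + q) ↔ T1 E w x))) ∧
    (T2 E w (p + q) → ((T2 E w (x + q) ↔ ¬ T2 E w x) ∧ (T2 E w (x + p) ↔ T2 E w x)))) := by
  have k := h.K p q x hp hq (h.nr hp hq)
  have c0 := col E w x
  have c1 := col E w (x + p)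
  have c2 := col E w (x + q)
  have c3 := col E w (x + p + q)
  have c4 := col E w (p + q)
  have n12' : ∀ v, T1 E w v → ¬ T2 E w v := fun v a b => n12 a b
  have n01' : ∀ v, T0 E w v → ¬ T1 E w v := fun v a b => n01 a b
  have n02' : ∀ v, T0 E w v → ¬ T2 E w v := fun v a b => n02 a b
  -- edges
  have e1 : ∀ u v r, v = u + r → T1 E w r → (T0 E w u → ¬ T2 E w v) ∧ (T2 E w u → ¬ T0 E w v) := by
    rintro u v r rfl hr
    exact ⟨fun a => h.nr01 a hr, fun a => by rw [add_comm]; exact h.nr hr a⟩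
  have e2 : ∀ u v r, v = u + r → T2 E w r → (T0 E w u → ¬ T1 E w v) ∧ (T1 E w u → ¬ T0 E w v) := by
    rintro u v r rfl hr
    exact ⟨fun a => h.nr02 a hr, fun a => h.nr a hr⟩
  have a1 := e1 x (x + p) p rfl hp
  have a2 := e1 (x + q) (x + p + q) p (by abel) hp
  have a3 := e1 x (x + p + q) (p + q) (by abel)
  have a4 := e1 (x + p) (x + q) (p + q) (by
    rw [add_assoc, h.hs'])
  have b1 := e2 x (x + q) q rfl hq
  have b2 := e2 (x + p) (x + p + q) q rfl hq
  have b3 := e2 x (x + p + q) (p + q) (by abel)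
  have b4 := e2 (x + p) (x + q) (p + q) (by
    rw [add_assoc, h.hs'])
  have c4' : ¬ T0 E w (p + q) := h.nr hp hq
  have i0 := n12' x
  have i1 := n12' (x + p)
  have i2 := n12' (x + q)
  have i3 := n12' (x + p + q)
  have i4 := n12' (p + q)
  have j0 := n01' x
  have j1 := n01' (x + p)
  have j2 := n01' (x + q)
  have j3 := n01' (x + p + q)
  have k0 := n02' x
  have k1 := n02' (x + p)
  have k2 := n02' (x + q)
  have k3 := n02' (x + p + q)
  clear e1 e2 n12' n01' n02'
  generalize T0 E w x = x0, T1 E w x = x1, T2 E w x = x2, T0 E w (x + p) = p0,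
    T1 E w (x + p) = p1, T2 E w (x + p) = p2, T0 E w (x + q) = q0,
    T1 E w (x + q) = q1, T2 E w (x + q) = q2, T0 E w (x + p + q) = r0,
    T1 E w (x + p + q) = r1, T2 E w (x + p + q) = r2, T1 E w (p + q) = s1,
    T2 E w (p + q) = s2 at *
  clear hp hq h
  rcases c4 with c4 | c4 | c4 <;> grind

theorem Ctx.nonzero (h : Ctx E w) {a : V} (ha : E a) : ¬ T0 E w a := fun hc => hc.1 ha

theorem Ctx.C (h : Ctx E w) (p q x : V) (hp : T1 E w p) (hq : T2 E w q)
    (z0 : T0 E w x) (zp : T0 E w (x + p)) (zq : T0 E w (x + q)) : False := by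
  have hx0 : x ≠ 0 := by
    rintro rfl
    rw [zero_add] at zp
    exact n01 zp hp
  rcases h.hsp x with hx | hx | ⟨a, b, ha, hb, rfl⟩
  · exact hx0 hx
  · exact z0.1 hx
  have ta := col E w a
  have tb := col E w b
  have na := h.nonzero ha
  have nb := h.nonzero hb
  have hab : a ≠ b := by
    rintro rfl
    exact hx0 (h.hs a)
  have Ba := h.B p q a hp hq
  have Bb := h.B p q b hp hq
  have z0' : T0 E w (b + a) := by rwa [add_comm]
  -- contradiction from a chosen third element
  have fin : ∀ r, E r → T0 E w (a + r) → T0 E w (b + r) → T0 E w (a + b + r) → False := by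
    intro r hr h1 h2 h3
    have hh := h.hI a b r ha hb hr hab
      (by rintro rfl
          rw [add_right_comm, h.hs, zero_add] at h3
          exact nb h3)
      (by rintro rfl
          rw [add_assoc, h.hs, add_zero] at h3
          exact na h3)
    rcases hh with hh | hh | hh | hh
    · exact z0.1 hh
    · exact h1.1 hh
    · exact h2.1 hh
    · exact h3.1 hh
  rcases Ba with Ba | Ba
  · exact na Ba.1
  rcases Bb with Bb | Bb
  · exact nb Bb.1
  rcases col E w (p + q) with hpq | hpq | hpq
  · exact h.nr hp hq hpq
  · have Ba := Ba.1 hpq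
    have Bb := Bb.1 hpq
    have a1 : T1 E w a := by
      rcases ta with t | t | t
      · exact absurd t na
      · exact t
      · exfalso
        by_cases hb1 : T1 E w b
        · exact h.nr hb1 t z0'
        · refine h.nr (Bb.1.2 hb1) t ?_
          rw [add_right_comm, add_comm b a]; exact zp
    have b1 : T1 E w b := by
      rcases tb with t | t | t
      · exact absurd t nb
      · exact t
      · exact absurd z0 (h.nr a1 t)
    have ap : T0 E w (a + p) := by
      rcases col E w (a + p) with t | t | t
      · exact t
      · exact absurd a1 (Ba.1.1 t)
      · exfalso
        refine h.nr b1 t ?_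
        rw [← add_assoc, add_comm b a]; exact zp
    have bp : T0 E w (b + p) := by
      rcases col E w (b + p) with t | t | t
      · exact t
      · exact absurd b1 (Bb.1.1 t)
      · exfalso
        refine h.nr a1 t ?_
        rw [← add_assoc]; exact zp
    rcases hp with hp | hp
    · exact fin p hp.1 ap bp zp
    · refine fin (p + w) hp.2 ?_ ?_ ?_
      · rw [← add_assoc, h.T0w]; exact ap
      · rw [← add_assoc, h.T0w]; exact bp
      · rw [← add_assoc, h.T0w]; exact zp
  · have Ba := Ba.2 hpq
    have Bb := Bb.2 hpq
    have a1 : T2 E w a := by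
      rcases ta with t | t | t
      · exact absurd t na
      · exfalso
        by_cases hb1 : T2 E w b
        · exact h.nr t hb1 z0
        · refine h.nr t (Bb.1.2 hb1) ?_
          rw [← add_assoc]; exact zq
      · exact t
    have b1 : T2 E w b := by
      rcases tb with t | t | t
      · exact absurd t nb
      · exact absurd z0' (h.nr t a1)
      · exact t
    have ap : T0 E w (a + q) := by
      rcases col E w (a + q) with t | t | t
      · exact t
      · exfalso
        refine h.nr t b1 ?_
        rw [add_right_comm]; exact zq
      · exact absurd a1 (Ba.1.1 t)
    have bp : T0 E w (b + q) := by
      rcases col E w (b + q) with t | t | t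
      · exact t
      · exfalso
        refine h.nr t a1 ?_
        rw [add_right_comm, add_comm b a]; exact zq
      · exact absurd b1 (Bb.1.1 t)
    exact fin q hq.1 ap bp zq

theorem Ctx.B' (h : Ctx E w) (p q x : V) (hp : T1 E w p) (hq : T2 E w q) :
    ((T1 E w (p + q) → ((T1 E w (x + p) ↔ ¬ T1 E w x) ∧ (T1 E w (x + q) ↔ T1 E w x))) ∧
    (T2 E w (p + q) → ((T2 E w (x + q) ↔ ¬ T2 E w x) ∧ (T2 E w (x + p) ↔ T2 E w x)))) := by
  rcases h.B p q x hp hq with hh | hh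
  · exact (h.C p q x hp hq hh.1 hh.2.1 hh.2.2.1).elim
  · exact hh

theorem Ctx.main (h : Ctx E w) {p q : V} (hp : T1 E w p) (hq : T2 E w q) :
    (∀ x y, T1 E w (x + y) ↔ ¬ (T1 E w x ↔ T1 E w y)) ∨
    (∀ x y, T2 E w (x + y) ↔ ¬ (T2 E w x ↔ T2 E w y)) := by
  rcases col E w (p + q) with hpq | hpq | hpq
  · exact absurd hpq (h.nr hp hq)
  · left
    have key : ∀ x, T1 E w x → ∀ y, (T1 E w (y + x) ↔ ¬ T1 E w y) := by
      intro x hx y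
      have h1 := ((h.B' p q x hp hq).1 hpq).2.2 hx
      exact ((h.B' x q y hx hq).1 h1).1
    intro x y
    by_cases hx : T1 E w x
    · rw [add_comm, key x hx y]; tauto
    · have h1 := (key p hp x).2 hx
      have h2 := key _ h1 y
      rw [← add_assoc, key p hp, add_comm y x] at h2
      grind
  · right
    have key : ∀ x, T2 E w x → ∀ y, (T2 E w (y + x) ↔ ¬ T2 E w y) := by
      intro x hx y
      have h1 := ((h.B' p q x hp hq).2 hpq).2.2 hx
      rw [add_comm] at h1
      exact ((h.B' p x y hp hx).2 h1).1
    intro x y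
    by_cases hx : T2 E w x
    · rw [add_comm, key x hx y]; tauto
    · have h1 := (key q hq x).2 hx
      have h2 := key _ h1 y
      rw [← add_assoc, key q hq, add_comm y x] at h2
      grind

/-- every vector is `0`, in `E`, or a sum of two elements of `E` -/
theorem span_two {n : ℕ} (S : Set (Fin n → ZMod 2)) (hs : ∀ x : Fin n → ZMod 2, x + x = 0)
    (hI : ∀ a b c, a ∈ S → b ∈ S → c ∈ S → a ≠ b → a ≠ c → b ≠ c →
      a + b ∈ S ∨ a + c ∈ S ∨ b + c ∈ S ∨ a + b + c ∈ S)
    (hsp : Submodule.span (ZMod 2) S = ⊤) (v : Fin n → ZMod 2) :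
    v = 0 ∨ v ∈ S ∨ ∃ a b, a ∈ S ∧ b ∈ S ∧ v = a + b := by
  have step : ∀ v c, c ∈ S → (v = 0 ∨ v ∈ S ∨ ∃ a b, a ∈ S ∧ b ∈ S ∧ v = a + b) →
      (v + c = 0 ∨ v + c ∈ S ∨ ∃ a b, a ∈ S ∧ b ∈ S ∧ v + c = a + b) := by
    rintro v c hc (rfl | hv | ⟨a, b, ha, hb, rfl⟩)
    · right; left; simpa using hc
    · right; right; exact ⟨v, c, hv, hc, rfl⟩
    · by_cases hab : a = b
      · subst hab
        right; left
        rw [hs, zero_add]; exact hc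
      by_cases hac : a = c
      · subst hac
        right; left
        rw [add_right_comm, hs, zero_add]; exact hb
      by_cases hbc : b = c
      · subst hbc
        right; left
        rw [add_assoc, hs, add_zero]; exact ha
      right
      rcases hI a b c ha hb hc hab hac hbc with k | k | k | k
      · right; exact ⟨a + b, c, k, hc, rfl⟩
      · right; exact ⟨a + c, b, k, hb, add_right_comm _ _ _⟩
      · right; exact ⟨a, b + c, ha, k, add_assoc _ _ _⟩
      · left; exact k
  have hv : v ∈ Submodule.span (ZMod 2) S := by rw [hsp]; trivial
  induction hv using Submodule.span_induction with
  | mem x hx => right; left; exact hx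
  | zero => left; rfl
  | add x y _ _ ihx ihy =>
    rcases ihy with rfl | hy | ⟨a, b, ha, hb, rfl⟩
    · simpa using ihx
    · exact step x y hy ihx
    · rw [← add_assoc]
      exact step _ b hb (step _ a ha ihx)
  | smul r x _ ihx =>
    have : r = 0 ∨ r = 1 := by revert r; decide
    rcases this with rfl | rfl
    · left; simp
    · simpa using ihx

theorem self2 {n : ℕ} (x : Fin n → ZMod 2) : x + x = 0 := by
  ext i
  exact CharTwo.add_self_eq_zero _

/-- the linear map of a triple -/
def triple {n : ℕ} (a b c : Fin n → ZMod 2) : (Fin 3 → ZMod 2) →ₗ[ZMod 2] (Fin n → ZMod 2) :=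
  Fintype.linearCombination (ZMod 2) ![a, b, c]

theorem triple_apply {n : ℕ} (a b c : Fin n → ZMod 2) (v : Fin 3 → ZMod 2) :
    triple a b c v = v 0 • a + v 1 • b + v 2 • c := by
  simp [triple, Fintype.linearCombination_apply, Fin.sum_univ_three]

theorem z2 (r : ZMod 2) : r = 0 ∨ r = 1 := by revert r; decide

theorem eq_of_add {n : ℕ} {x y : Fin n → ZMod 2} (h : x + y = 0) : x = y := by
  have := self2 y
  rw [← h] at this
  exact (add_right_cancel this).symm

theorem triple_inj {n : ℕ} {a b c : Fin n → ZMod 2} (ha : a ≠ 0) (hb : b ≠ 0) (hc : c ≠ 0)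
    (hab : a + b ≠ 0) (hac : a + c ≠ 0) (hbc : b + c ≠ 0) (habc : a + b + c ≠ 0) :
    Function.Injective (triple a b c) := by
  rw [← LinearMap.ker_eq_bot, LinearMap.ker_eq_bot']
  intro v hv
  rw [triple_apply] at hv
  rcases z2 (v 0) with h0 | h0 <;> rcases z2 (v 1) with h1 | h1 <;> rcases z2 (v 2) with h2 | h2 <;>
    simp only [h0, h1, h2, zero_smul, one_smul, zero_add, add_zero] at hv <;>
    first
    | contradiction
    | (ext i; fin_cases i <;> assumption)

theorem axF7 (M : BinMatroid) (hF7 : ¬ M.HasIR F7) (a b c : Fin M.dim → ZMod 2) :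
    ¬ (a ∈ M.E ∧ b ∈ M.E ∧ c ∈ M.E ∧ a + b ∈ M.E ∧ a + c ∈ M.E ∧ b + c ∈ M.E ∧
      a + b + c ∈ M.E) := by
  rintro ⟨ha, hb, hc, hab, hac, hbc, habc⟩
  apply hF7
  have nz : ∀ x, x ∈ M.E → x ≠ 0 := by
    rintro x hx rfl
    exact M.zero_not_mem hx
  have inj := triple_inj (nz _ ha) (nz _ hb) (nz _ hc) (nz _ hab) (nz _ hac) (nz _ hbc) (nz _ habc)
  refine ⟨triple a b c, inj, ?_⟩
  have hmem : ∀ v : Fin 3 → ZMod 2, v ≠ 0 → triple a b c v ∈ M.E := by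
    intro v hv
    rw [triple_apply]
    rcases z2 (v 0) with h0 | h0 <;> rcases z2 (v 1) with h1 | h1 <;>
      rcases z2 (v 2) with h2 | h2 <;>
      simp only [h0, h1, h2, zero_smul, one_smul, zero_add, add_zero] <;>
      first
      | assumption
      | (exact absurd (by ext i; fin_cases i <;> assumption) hv)
  ext y
  constructor
  · rintro ⟨v, hv, rfl⟩
    have := hmem v hv
    exact ⟨this, ⟨v, rfl⟩, nz _ this⟩
  · rintro ⟨_, ⟨v, rfl⟩, h0⟩
    refine ⟨v, ?_, rfl⟩
    rintro rfl
    exact h0 (map_zero _)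

theorem axI3 (M : BinMatroid) (hI3 : ¬ M.HasIR I3) (a b c : Fin M.dim → ZMod 2)
    (ha : a ∈ M.E) (hb : b ∈ M.E) (hc : c ∈ M.E) (hab : a ≠ b) (hac : a ≠ c) (hbc : b ≠ c) :
    a + b ∈ M.E ∨ a + c ∈ M.E ∨ b + c ∈ M.E ∨ a + b + c ∈ M.E := by
  by_contra hcon
  push Not at hcon
  obtain ⟨k1, k2, k3, k4⟩ := hcon
  apply hI3
  have nz : ∀ x, x ∈ M.E → x ≠ 0 := by
    rintro x hx rfl
    exact M.zero_not_mem hx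
  have inj := triple_inj (nz _ ha) (nz _ hb) (nz _ hc) (fun h => hab (eq_of_add h))
    (fun h => hac (eq_of_add h)) (fun h => hbc (eq_of_add h))
    (fun h => k1 (by rw [eq_of_add h]; exact hc))
  have hmem : ∀ v : Fin 3 → ZMod 2, triple a b c v ∈ M.E →
      ∃ i : Fin 3, (Pi.single i 1 : Fin 3 → ZMod 2) = v := by
    intro v hy
    have hz := M.zero_not_mem
    rw [triple_apply] at hy
    rcases z2 (v 0) with h0 | h0 <;> rcases z2 (v 1) with h1 | h1 <;>
      rcases z2 (v 2) with h2 | h2 <;>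
      simp only [h0, h1, h2, zero_smul, one_smul, zero_add, add_zero] at hy <;>
      first
      | contradiction
      | (refine ⟨0, ?_⟩; ext i; fin_cases i <;> simp [h0, h1, h2]; done)
      | (refine ⟨1, ?_⟩; ext i; fin_cases i <;> simp [h0, h1, h2]; done)
      | (refine ⟨2, ?_⟩; ext i; fin_cases i <;> simp [h0, h1, h2]; done)
  refine ⟨triple a b c, inj, ?_⟩
  ext y
  constructor
  · rintro ⟨v, ⟨i, rfl⟩, rfl⟩
    have : triple a b c (Pi.single i 1) ∈ M.E := by
      rw [triple_apply]
      fin_cases i <;> simpa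
    exact ⟨this, ⟨_, rfl⟩, nz _ this⟩
  · rintro ⟨hy, ⟨v, rfl⟩, _⟩
    exact ⟨v, hmem v hy, rfl⟩

theorem bset1 {n : ℕ} (E : Set (Fin n → ZMod 2)) {w : Fin n → ZMod 2} (hw : w ≠ 0)
    (x : Fin n → ZMod 2) :
    (({x, x + w} : Set (Fin n → ZMod 2)) ∩ E).ncard = 1 ↔ T1 (· ∈ E) w x := by
  have hne : x ≠ x + w := by simpa using hw
  unfold T1
  by_cases h1 : x ∈ E <;> by_cases h2 : x + w ∈ E <;>
    simp [Set.insert_inter_of_mem, Set.insert_inter_of_notMem, h1, h2, Set.ncard_pair hne]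

theorem bset2 {n : ℕ} (E : Set (Fin n → ZMod 2)) {w : Fin n → ZMod 2} (hw : w ≠ 0)
    (x : Fin n → ZMod 2) :
    (({x, x + w} : Set (Fin n → ZMod 2)) ∩ E).ncard = 2 ↔ T2 (· ∈ E) w x := by
  have hne : x ≠ x + w := by simpa using hw
  unfold T2
  by_cases h1 : x ∈ E <;> by_cases h2 : x + w ∈ E <;>
    simp [Set.insert_inter_of_mem, Set.insert_inter_of_notMem, h1, h2, Set.ncard_pair hne]

open Classical in
/-- an additive predicate gives a hyperplane -/
theorem hyper {n : ℕ} (T : (Fin n → ZMod 2) → Prop)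
    (hT : ∀ x y, T (x + y) ↔ ¬ (T x ↔ T y))
    (H : Submodule (ZMod 2) (Fin n → ZMod 2)) (hne : ∃ x ∈ H, T x) :
    ∃ H₀ : Submodule (ZMod 2) (Fin n → ZMod 2),
      H₀ ≤ H ∧ Module.finrank (ZMod 2) H₀ + 1 = Module.finrank (ZMod 2) H ∧
      ∀ x ∈ H, (x ∈ H₀ ↔ ¬ T x) := by
  let f0 : H →+ ZMod 2 := AddMonoidHom.mk' (fun x => if T (x : Fin n → ZMod 2) then 1 else 0) (by
    intro x y
    have := hT x y
    by_cases h1 : T (x : Fin n → ZMod 2) <;> by_cases h2 : T (y : Fin n → ZMod 2) <;>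
      simp [h1, h2, this]
    decide)
  let f : Module.Dual (ZMod 2) H := f0.toZModLinearMap 2
  have hf : ∀ x : H, f x = if T (x : Fin n → ZMod 2) then 1 else 0 := fun x => rfl
  have fne : f ≠ 0 := by
    obtain ⟨x, hx, hTx⟩ := hne
    intro e
    have := hf ⟨x, hx⟩
    rw [e] at this
    simp [hTx] at this
  refine ⟨(LinearMap.ker f).map H.subtype, Submodule.map_subtype_le _ _, ?_, ?_⟩
  · rw [Submodule.finrank_map_subtype_eq]
    exact Module.Dual.finrank_ker_add_one_of_ne_zero fne
  · intro x hx
    simp only [Submodule.mem_map, LinearMap.mem_ker, hf]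
    constructor
    · rintro ⟨y, hy, rfl⟩ hTy
      simp at hy
      exact hy hTy
    · intro h
      exact ⟨⟨x, hx⟩, by simp [h], rfl⟩

end Stmt18Aux

/-- Let `M = (E, G)` be a full-rank `n`-dimensional matroid with no
induced `I₃`- or `F₇`-restriction, `w ∈ G − E`, `H` a hyperplane of `G` not containing
`w`, and `B_i = {x ∈ H : |{x, x+w} ∩ E| = i}`. If `B₁` and `B₂` are both nonempty, then
for some `i ∈ {1, 2}` the matroid `(B_i, H)` is isomorphic to `AG(n−2, 2)`, i.e.
`B_i = H − H₀` for some hyperplane `H₀` of `H`. -/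
theorem stmt18 (M : BinMatroid) (hfull : M.FullRank)
    (hI3 : ¬ M.HasIR I3) (hF7 : ¬ M.HasIR F7)
    (w : Fin M.dim → ZMod 2) (hw0 : w ≠ 0) (hwE : w ∉ M.E)
    (H : Submodule (ZMod 2) (Fin M.dim → ZMod 2))
    (hH : Module.finrank (ZMod 2) H + 1 = M.dim) (hwH : w ∉ H)
    (h1 : (Bset M.E H w 1).Nonempty) (h2 : (Bset M.E H w 2).Nonempty) :
    ∃ i ∈ ({1, 2} : Set ℕ), ∃ H₀ : Submodule (ZMod 2) (Fin M.dim → ZMod 2),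
      H₀ ≤ H ∧ Module.finrank (ZMod 2) H₀ + 1 = Module.finrank (ZMod 2) H ∧
      Bset M.E H w i =
        (H : Set (Fin M.dim → ZMod 2)) \ (H₀ : Set (Fin M.dim → ZMod 2)) := by
  have ctx : Stmt18Aux.Ctx (· ∈ M.E) w :=
    { hs := Stmt18Aux.self2
      h0 := M.zero_not_mem
      hw := hwE
      hw0 := hw0
      hI := Stmt18Aux.axI3 M hI3
      hF := Stmt18Aux.axF7 M hF7
      hsp := Stmt18Aux.span_two M.E Stmt18Aux.self2 (Stmt18Aux.axI3 M hI3) hfull }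
  obtain ⟨p, ⟨hpH, _⟩, hp⟩ := h1
  obtain ⟨q, ⟨hqH, _⟩, hq⟩ := h2
  rw [Stmt18Aux.bset1 M.E hw0] at hp
  rw [Stmt18Aux.bset2 M.E hw0] at hq
  rcases ctx.main hp hq with hT | hT
  · obtain ⟨H₀, hle, hdim, hmem⟩ := Stmt18Aux.hyper _ hT H ⟨p, hpH, hp⟩
    refine ⟨1, by simp, H₀, hle, hdim, ?_⟩
    ext x
    simp only [Bset, Set.mem_setOf_eq, Set.mem_diff, SetLike.mem_coe, Set.mem_singleton_iff,
      Stmt18Aux.bset1 M.E hw0]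
    constructor
    · rintro ⟨⟨hx, _⟩, hx1⟩
      exact ⟨hx, fun hc => (hmem x hx).1 hc hx1⟩
    · rintro ⟨hx, hx1⟩
      refine ⟨⟨hx, ?_⟩, by_contra fun hc => hx1 ((hmem x hx).2 hc)⟩
      rintro rfl
      exact hx1 H₀.zero_mem
  · obtain ⟨H₀, hle, hdim, hmem⟩ := Stmt18Aux.hyper _ hT H ⟨q, hqH, hq⟩
    refine ⟨2, by simp, H₀, hle, hdim, ?_⟩
    ext x
    simp only [Bset, Set.mem_setOf_eq, Set.mem_diff, SetLike.mem_coe, Set.mem_singleton_iff,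
      Stmt18Aux.bset2 M.E hw0]
    constructor
    · rintro ⟨⟨hx, _⟩, hx1⟩
      exact ⟨hx, fun hc => (hmem x hx).1 hc hx1⟩
    · rintro ⟨hx, hx1⟩
      refine ⟨⟨hx, ?_⟩, by_contra fun hc => hx1 ((hmem x hx).2 hc)⟩
      rintro rfl
      exact hx1 H₀.zero_mem
end
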